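/- arXiv:math/0208016 — 2 statements merged into one kernel-verified Lean document; each statement's English description precedes it below -/
import Mathlib

section
/- Let D be a bounded domain in ℂ, let S ⊆ D be a closed disc, and let K ⊆ ∂D be a compact polar set. Then for every z ∈ D, ω(z, S, D) = inf{ω(z, S, D ∪ U) : U open, K ⊆ U}. Moreover, if z ∈ K is a regular boundary point of D, then inf{ω(z, S, D ∪ U) : U open, K ⊆ U} = 0. -/
open Set Metric MeasureTheory Filter Topology

noncomputable section

open Classical in
/-- The average of an `EReal`-valued function over the circle of center `z` and radius `r`;
it is `⊥` if the function equals `⊥` on a set of positive measure of the circle or if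
its (finite) values are not integrable over the circle. -/
def circleAvg (u : ℂ → EReal) (z : ℂ) (r : ℝ) : EReal :=
  if (IntervalIntegrable (fun θ : ℝ => (u (circleMap z r θ)).toReal) volume 0 (2 * Real.pi)
      ∧ ∀ᵐ θ ∂(volume.restrict (Set.Ioc (0:ℝ) (2 * Real.pi))), u (circleMap z r θ) ≠ ⊥)
  then (((∫ θ in (0:ℝ)..(2 * Real.pi), (u (circleMap z r θ)).toReal) / (2 * Real.pi) : ℝ) : EReal)
  else ⊥

/-- `u` is plurisubharmonic on a (typically open) set `Ω` of a complex vector space: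
it takes values in `[-∞, ∞)`, is upper semicontinuous on `Ω`, is not identically `-∞`
on any connected component of `Ω`, and its restriction to every complex line satisfies
the sub-mean value inequality on circles (whose closed discs lie in `Ω`). -/
def PSHOn {E : Type*} [NormedAddCommGroup E] [NormedSpace ℂ E]
    (u : E → EReal) (Ω : Set E) : Prop :=
  (∀ z ∈ Ω, u z ≠ ⊤) ∧
  UpperSemicontinuousOn u Ω ∧
  (∀ z ∈ Ω, ∃ w ∈ connectedComponentIn Ω z, u w ≠ ⊥) ∧
  ∀ a b : E, ∀ c : ℂ, ∀ r : ℝ, 0 < r →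
    (∀ l ∈ Metric.closedBall c r, a + l • b ∈ Ω) →
    u (a + c • b) ≤ circleAvg (fun l : ℂ => u (a + l • b)) c r

/-- In one complex variable, plurisubharmonic = subharmonic. -/
abbrev SubharmonicOn (u : ℂ → EReal) (Ω : Set ℂ) : Prop := PSHOn u Ω

/-- A set `P ⊆ ℂ` is polar if `P ⊆ {u = -∞}` for some subharmonic `u` on `ℂ`
(not identically `-∞`). -/
def PolarSet (P : Set ℂ) : Prop :=
  ∃ u : ℂ → EReal, SubharmonicOn u Set.univ ∧ ∀ z ∈ P, u z = ⊥

/-- `S` is pluripolar in `Ω`. -/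
def PluripolarIn {E : Type*} [NormedAddCommGroup E] [NormedSpace ℂ E]
    (S Ω : Set E) : Prop :=
  ∃ u : E → EReal, PSHOn u Ω ∧ ∀ z ∈ S, u z = ⊥

/-- `S` is complete pluripolar in `Ω`: `S` is exactly the `-∞`-set of some
plurisubharmonic function on `Ω`. -/
def CompletePluripolarIn {E : Type*} [NormedAddCommGroup E] [NormedSpace ℂ E]
    (S Ω : Set E) : Prop :=
  ∃ u : E → EReal, PSHOn u Ω ∧ ∀ z ∈ Ω, (u z = ⊥ ↔ z ∈ S)

/-- The pluripolar hull `S*_Ω` of `S` in `Ω`. -/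
def pluripolarHull {E : Type*} [NormedAddCommGroup E] [NormedSpace ℂ E]
    (S Ω : Set E) : Set E :=
  {z ∈ Ω | ∀ u : E → EReal, PSHOn u Ω → (∀ w ∈ S, u w = ⊥) → u z = ⊥}

/-- `S` is (pluri-)thin at `ζ`: either `ζ` is not a limit point of `S \ {ζ}`, or there is
a plurisubharmonic function on a neighborhood of `ζ` with
`limsup_{z → ζ, z ∈ S \ {ζ}} u z < u ζ`. -/
def PluriThinAt {E : Type*} [NormedAddCommGroup E] [NormedSpace ℂ E]
    (S : Set E) (ζ : E) : Prop :=
  ζ ∉ closure (S \ {ζ}) ∨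
  ∃ U : Set E, IsOpen U ∧ ζ ∈ U ∧ ∃ u : E → EReal, PSHOn u U ∧
    Filter.limsup u (nhdsWithin ζ (S \ {ζ})) < u ζ

/-- Thinness in `ℂ`. -/
abbrev ThinAt (S : Set ℂ) (ζ : ℂ) : Prop := PluriThinAt S ζ

/-- The relative extremal function (pluriharmonic measure) `ω(z, A, D)`:
`-sup { u(z) : u` psh on `D`, `u ≤ 0` on `D`, `u ≤ -1` on `A }`, where for points of `A`
not belonging to `D` the condition `u ≤ -1` is understood as
`limsup_{ζ → w, ζ ∈ D} u(ζ) ≤ -1` (for `w ∈ A ∩ D` and `u` upper semicontinuous the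
condition below is equivalent to `u w ≤ -1`). -/
def relExtremal {E : Type*} [NormedAddCommGroup E] [NormedSpace ℂ E]
    (z : E) (A D : Set E) : EReal :=
  - sSup {y : EReal | ∃ u : E → EReal, PSHOn u D ∧ (∀ w ∈ D, u w ≤ 0) ∧
      (∀ w ∈ A, Filter.limsup u (nhdsWithin w (insert w D)) ≤ -1) ∧ y = u z}

/-- `ζ` is a regular boundary point of `Ω` if `ζ ∈ ∂Ω` and `ℂ \ Ω` is non-thin at `ζ`. -/
def RegularBoundaryPoint (Ω : Set ℂ) (ζ : ℂ) : Prop :=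
  ζ ∈ frontier Ω ∧ ¬ ThinAt Ωᶜ ζ

/-- The graph `Γ_f = {(z, f z) : z ∈ S} ⊆ ℂ²` of `f` over `S`. -/
def graphOver (f : ℂ → ℂ) (S : Set ℂ) : Set (ℂ × ℂ) := {p | p.1 ∈ S ∧ p.2 = f p.1}

/-- `e^x` for `x ∈ [-∞, ∞)`, as a map to `[0, ∞)`. -/
def expEReal (x : EReal) : ℝ := if x = ⊥ then 0 else Real.exp x.toReal

end

namespace SH13

lemma re_mean {f : ℂ → ℂ} (hf : Differentiable ℂ f) (c : ℂ) (r : ℝ) :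
    (∫ θ in (0:ℝ)..(2 * Real.pi), (f (circleMap c r θ)).re) / (2 * Real.pi) = (f c).re := by
  have h := (hf.diffContOnCl (s := ball c |r|)).circleAverage
  have hi : IntervalIntegrable (fun θ : ℝ => f (circleMap c r θ)) volume 0 (2 * Real.pi) := by
    apply Continuous.intervalIntegrable
    exact hf.continuous.comp (continuous_circleMap c r)
  rw [← h, Real.circleAverage_def]
  have h2 := (Complex.reCLM).intervalIntegral_comp_comm hi
  simp only [Complex.reCLM_apply] at h2
  rw [h2]
  simp [div_eq_inv_mul]

lemma re_max {f g : ℂ → ℂ} (hf : Differentiable ℂ f) (hg : Differentiable ℂ g) {c : ℂ} {r : ℝ}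
    (hr : 0 < r) (h : ∀ x ∈ sphere c r, (f x).re ≤ (g x).re) :
    ∀ x ∈ closedBall c r, (f x).re ≤ (g x).re := by
  intro x hx
  have hF : Differentiable ℂ (fun x => Complex.exp (f x - g x)) := by fun_prop
  have := Complex.norm_le_of_forall_mem_frontier_norm_le (U := ball c r) (C := 1)
    isBounded_ball hF.diffContOnCl (z := x) (by
      intro y hy
      rw [frontier_ball c hr.ne'] at hy
      rw [Complex.norm_exp, Real.exp_le_one_iff]
      have := h y hy
      simp; linarith) (by rw [closure_ball c hr.ne']; exact hx)
  rw [Complex.norm_exp, Real.exp_le_one_iff] at this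
  simp at this; linarith

lemma harnack {f : ℂ → ℂ} (hf : Differentiable ℂ f) {c w : ℂ} {r : ℝ}
    (hw : w ∈ ball c r) (h : ∀ x ∈ sphere c r, 0 ≤ (f x).re) :
    (r - ‖w - c‖) / (r + ‖w - c‖) * (f c).re ≤ (f w).re ∧
    (f w).re ≤ (r + ‖w - c‖) / (r - ‖w - c‖) * (f c).re := by
  have hr : 0 < r := pos_of_mem_ball hw
  have h1 := (hf.diffContOnCl (s := ball c r)).circleAverage_re_herglotzRieszKernel_smul hw
  have hk : ContinuousOn (fun θ : ℝ => herglotzRieszKernel c w (circleMap c r θ)) univ := by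
    apply (continuousOn_herglotzRieszKernel_sphere hw).comp (continuous_circleMap c r).continuousOn
    intro θ _
    rw [abs_of_pos hr]; exact circleMap_mem_sphere c hr.le θ
  rw [continuousOn_univ] at hk
  have hc : Continuous (fun θ : ℝ => f (circleMap c r θ)) := hf.continuous.comp (continuous_circleMap c r)
  rw [Real.circleAverage_def] at h1
  have hi : IntervalIntegrable (fun θ : ℝ => (Complex.re ∘ herglotzRieszKernel c w • f) (circleMap c r θ)) volume 0 (2 * Real.pi) := by
    apply Continuous.intervalIntegrable
    simp only [Pi.smul_apply', Function.comp_apply]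
    exact (Complex.continuous_re.comp hk).smul hc
  have h2 := (Complex.reCLM).intervalIntegral_comp_comm hi
  simp only [Complex.reCLM_apply] at h2
  have h3 : (f w).re = (2 * Real.pi)⁻¹ * ∫ θ in (0:ℝ)..(2 * Real.pi), (herglotzRieszKernel c w (circleMap c r θ)).re * (f (circleMap c r θ)).re := by
    rw [← h1, Complex.smul_re, ← h2]
    simp
  have hpi : 0 < 2 * Real.pi := by positivity
  have hcre : Continuous (fun θ : ℝ => (f (circleMap c r θ)).re) := Complex.continuous_re.comp hc
  have hcc : Continuous (fun θ : ℝ => (herglotzRieszKernel c w (circleMap c r θ)).re * (f (circleMap c r θ)).re) :=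
    (Complex.continuous_re.comp hk).mul hcre
  rw [h3, ← re_mean hf c r, div_eq_inv_mul _ (2 * Real.pi)]
  constructor
  · rw [mul_left_comm]
    apply mul_le_mul_of_nonneg_left _ (by positivity)
    rw [← intervalIntegral.integral_const_mul]
    apply intervalIntegral.integral_mono_on hpi.le
    · exact (continuous_const.mul hcre).intervalIntegrable _ _
    · exact hcc.intervalIntegrable _ _
    · intro θ _
      have hs := circleMap_mem_sphere c hr.le θ
      exact mul_le_mul_of_nonneg_right (le_re_herglotzRieszKernel hs hw) (h _ hs)
  · rw [mul_left_comm _ (2 * Real.pi)⁻¹]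
    apply mul_le_mul_of_nonneg_left _ (by positivity)
    rw [← intervalIntegral.integral_const_mul]
    apply intervalIntegral.integral_mono_on hpi.le
    · exact hcc.intervalIntegrable _ _
    · exact (continuous_const.mul hcre).intervalIntegrable _ _
    · intro θ _
      have hs := circleMap_mem_sphere c hr.le θ
      exact mul_le_mul_of_nonneg_right (re_herglotzRieszKernel_le hs hw) (h _ hs)

lemma exists_entire_approx {ψ : ℂ → ℝ} (hψ : Continuous ψ) (c : ℂ) {r : ℝ} (hr : 0 < r)
    {ε : ℝ} (hε : 0 < ε) :
    ∃ f : ℂ → ℂ, Differentiable ℂ f ∧ ∀ x ∈ sphere c r, |(f x).re - ψ x| < ε := by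
  have : Fact (0 < 2 * Real.pi) := ⟨by positivity⟩
  let e : AddCircle (2 * Real.pi) → ℂ := fun t => c + r * (AddCircle.toCircle t : ℂ)
  have he : Continuous e := by
    have : Continuous (fun t : AddCircle (2 * Real.pi) => (AddCircle.toCircle t : ℂ)) :=
      continuous_subtype_val.comp AddCircle.continuous_toCircle
    fun_prop
  let g : C(AddCircle (2 * Real.pi), ℂ) := ⟨fun t => (ψ (e t) : ℂ), by fun_prop⟩
  have hspan : ∀ s ∈ Submodule.span ℂ (range (@fourier (2 * Real.pi))), ∀ a : ℂ,
      ∃ f : ℂ → ℂ, Differentiable ℂ f ∧ ∀ t, (f (e t)).re = (a * s t).re := by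
    intro s hs
    induction hs using Submodule.span_induction with
    | mem s hs =>
      obtain ⟨n, rfl⟩ := hs
      intro a
      have hrc : (r : ℂ) ≠ 0 := by exact_mod_cast hr.ne'
      have hee : ∀ t, (e t - c) / r = (AddCircle.toCircle t : ℂ) := by
        intro t; simp only [e]; field_simp; ring
      obtain ⟨m, rfl | rfl⟩ := n.eq_nat_or_neg
      · refine ⟨fun x => a * ((x - c) / r) ^ m, by fun_prop, fun t => ?_⟩
        simp only [hee]
        simp [fourier_apply, AddCircle.toCircle_nsmul]
      · refine ⟨fun x => (starRingEnd ℂ) a * ((x - c) / r) ^ m, by fun_prop, fun t => ?_⟩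
        simp only [hee]
        rw [fourier_neg]
        rw [← Complex.conj_re]
        simp [fourier_apply, AddCircle.toCircle_nsmul]
    | zero => intro a; exact ⟨fun _ => 0, by fun_prop, by simp⟩
    | add s t _ _ h1 h2 =>
      intro a
      obtain ⟨f1, hf1, h1⟩ := h1 a
      obtain ⟨f2, hf2, h2⟩ := h2 a
      refine ⟨fun x => f1 x + f2 x, by fun_prop, fun t => ?_⟩
      simp [h1, h2, mul_add]
    | smul b s _ h1 =>
      intro a
      obtain ⟨f1, hf1, h1⟩ := h1 (a * b)
      refine ⟨f1, hf1, fun t => ?_⟩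
      rw [h1]; simp [mul_assoc]
  have hg : g ∈ (Submodule.span ℂ (range (@fourier (2 * Real.pi)))).topologicalClosure := by
    rw [span_fourier_closure_eq_top]; trivial
  have hg' : g ∈ closure ((Submodule.span ℂ (range (@fourier (2 * Real.pi))) : Set C(AddCircle (2 * Real.pi), ℂ))) := hg
  rw [Metric.mem_closure_iff] at hg'
  obtain ⟨s, hs, hd⟩ := hg' ε hε
  obtain ⟨f, hf, hfs⟩ := hspan s hs 1
  refine ⟨f, hf, fun x hx => ?_⟩
  have hxe : ∃ t, e t = x := by
    obtain ⟨θ, hθ⟩ : x ∈ range (circleMap c r) := by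
      rw [range_circleMap, abs_of_pos hr]; exact hx
    refine ⟨(θ : AddCircle (2 * Real.pi)), ?_⟩
    simp only [e]
    rw [← hθ, AddCircle.toCircle_apply_mk]
    have : 2 * Real.pi / (2 * Real.pi) * θ = θ := by field_simp
    rw [this]
    simp [circleMap]
  obtain ⟨t, rfl⟩ := hxe
  rw [hfs, one_mul]
  have h1 : ‖g t - s t‖ < ε := by
    rw [← dist_eq_norm]
    exact lt_of_le_of_lt (ContinuousMap.dist_apply_le_dist t) hd
  have h2 : (s t).re - ψ (e t) = -(g t - s t).re := by simp [g]
  rw [h2, abs_neg]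
  exact lt_of_le_of_lt (Complex.abs_re_le_norm _) h1

end SH13

namespace SH13

lemma usc_approx {S : Set ℂ} (hS : IsCompact S) (hne : S.Nonempty) {u : ℂ → EReal}
    (hu : UpperSemicontinuousOn u S) (htop : ∀ x ∈ S, u x ≠ ⊤) :
    ∃ φ : ℕ → ℂ → ℝ, (∀ n, Continuous (φ n)) ∧ (∀ x, Antitone (fun n => φ n x)) ∧
      (∀ n, ∀ x ∈ S, u x ≤ (φ n x : ℝ)) ∧
      ∀ x ∈ S, ∀ a : ℝ, u x < a → ∃ n, φ n x ≤ a := by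
  obtain ⟨y0, hy0, hmax⟩ := hu.exists_isMaxOn hne hS
  obtain ⟨M, hM⟩ : ∃ M : ℝ, u y0 ≤ M := by
    induction h : u y0 with
    | bot => exact ⟨0, by simp⟩
    | coe a => exact ⟨a, le_rfl⟩
    | top => exact absurd h (htop _ hy0)
  have hM0 : ∀ y ∈ S, u y ≤ M := fun y hy => (hmax hy).trans hM
  have : Nonempty S := ⟨⟨y0, hy0⟩⟩
  -- truncations
  let t : ℕ → ℂ → ℝ := fun n y => (max (u y) ((-(n:ℝ) : ℝ) : EReal)).toReal
  have ht : ∀ n, ∀ y ∈ S, ((t n y : ℝ) : EReal) = max (u y) ((-(n:ℝ) : ℝ) : EReal) := by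
    intro n y hy
    apply EReal.coe_toReal
    · exact (max_lt (lt_top_iff_ne_top.2 (htop y hy)) (EReal.coe_lt_top _)).ne
    · exact (lt_of_lt_of_le (EReal.bot_lt_coe _) (le_max_right _ _)).ne'
  have htM : ∀ n, ∀ y ∈ S, t n y ≤ max M 0 := by
    intro n y hy
    rw [← EReal.coe_le_coe_iff, ht n y hy]
    apply max_le
    · exact (hM0 y hy).trans (EReal.coe_le_coe_iff.2 (le_max_left _ _))
    · apply EReal.coe_le_coe_iff.2
      exact le_trans (by simp) (le_max_right _ _)
  have hbdd : ∀ n x, BddAbove (range fun y : S => t n y - n * dist x (y : ℂ)) := by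
    intro n x
    refine ⟨max M 0, ?_⟩
    rintro _ ⟨y, rfl⟩
    have := htM n y y.2
    have h2 : 0 ≤ n * dist x (y : ℂ) := by positivity
    simp only; linarith
  refine ⟨fun n x => ⨆ y : S, (t n y - n * dist x (y : ℂ)), ?_, ?_, ?_, ?_⟩
  · intro n
    have : LipschitzWith (n : NNReal) (fun x : ℂ => ⨆ y : S, (t n y - n * dist x (y : ℂ))) := by
      apply LipschitzWith.of_le_add_mul
      intro x x'
      apply ciSup_le
      intro y
      have h1 := le_ciSup (hbdd n x') y
      have h2 := dist_triangle x' x (y : ℂ)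
      rw [dist_comm x' x] at h2
      have h3 : (n : ℝ) * dist x' (y : ℂ) ≤ n * (dist x x' + dist x y) :=
        mul_le_mul_of_nonneg_left h2 (by positivity)
      simp only [NNReal.coe_natCast]
      linarith
    exact this.continuous
  · intro x m n hmn
    apply ciSup_mono (hbdd m x)
    intro y
    have h1 : t n y ≤ t m y := by
      rw [← EReal.coe_le_coe_iff, ht n y y.2, ht m y y.2]
      apply max_le_max le_rfl
      apply EReal.coe_le_coe_iff.2
      simp [hmn]
    have h2 : (m : ℝ) * dist x (y : ℂ) ≤ n * dist x (y : ℂ) := by gcongr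
    linarith
  · intro n x hx
    have h1 := le_ciSup (hbdd n x) ⟨x, hx⟩
    simp only [dist_self, mul_zero, sub_zero] at h1
    calc u x ≤ (t n x : ℝ) := by rw [ht n x hx]; exact le_max_left _ _
      _ ≤ _ := EReal.coe_le_coe_iff.2 h1
  · intro x hx a ha
    have := hu x hx a ha
    obtain ⟨δ, hδ, hδ'⟩ := Metric.mem_nhdsWithin_iff.1 this
    obtain ⟨n, hn⟩ := exists_nat_gt (max (-a) ((max M 0 - a) / δ))
    refine ⟨n, ciSup_le fun y => ?_⟩
    have hn1 := (le_max_left _ _).trans_lt hn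
    have hn2 := (le_max_right _ _).trans_lt hn
    rw [div_lt_iff₀ hδ] at hn2
    by_cases hy : dist (y : ℂ) x < δ
    · have h3 : t n y ≤ a := by
        rw [← EReal.coe_le_coe_iff, ht n y y.2]
        apply max_le (le_of_lt (hδ' ⟨hy, y.2⟩))
        apply EReal.coe_le_coe_iff.2; linarith
      have h2 : 0 ≤ n * dist x (y : ℂ) := by positivity
      linarith
    · push Not at hy
      rw [dist_comm] at hy
      have := htM n y y.2
      have h4 : (n : ℝ) * δ ≤ n * dist x (y:ℂ) := by gcongr
      linarith

/-- decreasing entire approximants of a usc function on a circle -/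
lemma entire_approx {c : ℂ} {r : ℝ} (hr : 0 < r) {u : ℂ → EReal}
    (hu : UpperSemicontinuousOn u (sphere c r)) (htop : ∀ x ∈ sphere c r, u x ≠ ⊤) :
    ∃ f : ℕ → ℂ → ℂ, (∀ n, Differentiable ℂ (f n)) ∧
      (∀ x ∈ closedBall c r, Antitone (fun n => (f n x).re)) ∧
      (∀ n, ∀ x ∈ sphere c r, u x ≤ ((f n x).re : ℝ)) ∧
      ∀ x ∈ sphere c r, ∀ a : ℝ, u x < a → ∃ n, (f n x).re < a := by
  obtain ⟨φ, hc, ha, hge, hlim⟩ := usc_approx (isCompact_sphere c r)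
    ((NormedSpace.sphere_nonempty).2 hr.le) hu htop
  have hex : ∀ n : ℕ, ∃ f : ℂ → ℂ, Differentiable ℂ f ∧
      ∀ x ∈ sphere c r, |(f x).re - (φ n x + 3 * (1/2:ℝ)^n)| < (1/2:ℝ)^n := by
    intro n
    exact exists_entire_approx (ψ := fun x => φ n x + 3 * (1/2:ℝ)^n)
      ((hc n).add continuous_const) c hr (by positivity)
  choose f hf hfa using hex
  refine ⟨f, hf, ?_, ?_, ?_⟩
  · intro x hx
    apply antitone_nat_of_succ_le
    intro n
    apply re_max (hf _) (hf _) hr _ x hx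
    intro y hy
    have h1 := abs_lt.1 (hfa n y hy)
    have h2 := abs_lt.1 (hfa (n+1) y hy)
    have h3 := ha y (Nat.le_succ n)
    simp only [pow_succ] at h2
    simp only [Nat.succ_eq_add_one] at h3
    linarith [h1.1, h2.2]
  · intro n x hx
    refine (hge n x hx).trans (EReal.coe_le_coe_iff.2 ?_)
    have h1 := abs_lt.1 (hfa n x hx)
    have : (0:ℝ) < (1/2)^n := by positivity
    linarith [h1.1]
  · intro x hx a hxa
    obtain ⟨b, hb1, hb2⟩ := EReal.lt_iff_exists_real_btwn.1 hxa
    obtain ⟨n, hn⟩ := hlim x hx b hb1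
    have hb2' : b < a := EReal.coe_lt_coe_iff.1 hb2
    obtain ⟨m, hm⟩ := exists_pow_lt_of_lt_one (show 0 < (a - b)/4 by linarith) (show (1/2:ℝ) < 1 by norm_num)
    refine ⟨max m n, ?_⟩
    have h1 := abs_lt.1 (hfa (max m n) x hx)
    have h2 : φ (max m n) x ≤ φ n x := ha x (le_max_right _ _)
    have h3 : (1/2:ℝ)^(max m n) ≤ (1/2)^m := pow_le_pow_of_le_one (by norm_num) (by norm_num) (le_max_left _ _)
    linarith [h1.2]

/-- sub-mean value inequality tested against entire functions -/
def SM (u : ℂ → EReal) (c : ℂ) (r : ℝ) : Prop :=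
  ∀ f : ℂ → ℂ, Differentiable ℂ f → (∀ x ∈ sphere c r, u x ≤ ((f x).re : ℝ)) → u c ≤ ((f c).re : ℝ)

lemma SM_of_circleAvg {u : ℂ → EReal} {c : ℂ} {r : ℝ} (hr : 0 < r)
    (htop : ∀ x ∈ sphere c r, u x ≠ ⊤)
    (h : u c ≤ circleAvg u c r) : SM u c r := by
  intro f hf hle
  refine h.trans ?_
  unfold circleAvg
  split_ifs with hi
  · rw [← re_mean hf c r]
    apply EReal.coe_le_coe_iff.2
    apply div_le_div_of_nonneg_right _ (by positivity)
    have hpi : (0:ℝ) ≤ 2 * Real.pi := by positivity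
    rw [intervalIntegral.integral_of_le hpi, intervalIntegral.integral_of_le hpi]
    have hI : IntervalIntegrable (fun θ : ℝ => (f (circleMap c r θ)).re) volume 0 (2 * Real.pi) := by
      apply Continuous.intervalIntegrable
      exact Complex.continuous_re.comp (hf.continuous.comp (continuous_circleMap c r))
    apply integral_mono_ae hi.1.1 hI.1
    filter_upwards [hi.2] with θ hθ
    have hs := circleMap_mem_sphere c hr.le θ
    have := hle _ hs
    rw [← EReal.coe_toReal (htop _ hs) hθ] at this
    exact EReal.coe_le_coe_iff.1 this
  · exact bot_le

lemma circleAvg_of_SM {u : ℂ → EReal} {c : ℂ} {r : ℝ} (hr : 0 < r)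
    (hu : UpperSemicontinuousOn u (sphere c r))
    (htop : ∀ x ∈ sphere c r, u x ≠ ⊤) (h : SM u c r) : u c ≤ circleAvg u c r := by
  by_cases hbot : u c = ⊥
  · rw [hbot]; exact bot_le
  obtain ⟨f, hf, hanti, hge, hlim⟩ := entire_approx hr hu htop
  have hctop : u c ≠ ⊤ := ne_top_of_le_ne_top (EReal.coe_ne_top _) (h (f 0) (hf 0) (hge 0))
  have hc : ∀ n, (u c).toReal ≤ (f n c).re := by
    intro n
    rw [← EReal.coe_le_coe_iff, EReal.coe_toReal hctop hbot]
    exact h (f n) (hf n) (hge n)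
  have hpi : (0:ℝ) < 2 * Real.pi := by positivity
  set μ : Measure ℝ := volume.restrict (Set.Ioc (0:ℝ) (2 * Real.pi)) with hμ
  let F : ℕ → ℝ → ℝ := fun n θ => (f n (circleMap c r θ)).re
  have hFc : ∀ n, Continuous (F n) := fun n =>
    Complex.continuous_re.comp ((hf n).continuous.comp (continuous_circleMap c r))
  have hFi : ∀ n, Integrable (F n) μ := fun n => by
    have : IntervalIntegrable (F n) volume 0 (2 * Real.pi) := (hFc n).intervalIntegrable _ _
    exact this.1
  have hs : ∀ θ, circleMap c r θ ∈ sphere c r := fun θ => circleMap_mem_sphere c hr.le θ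
  have hFa : ∀ θ, Antitone (fun n => F n θ) := fun θ => hanti _ (sphere_subset_closedBall (hs θ))
  have hFint : ∀ n, ∫ θ, F n θ ∂μ = 2 * Real.pi * (f n c).re := by
    intro n
    rw [← re_mean (hf n) c r, intervalIntegral.integral_of_le hpi.le]
    field_simp
    rfl
  -- monotone convergence
  let G : ℕ → ℝ → ENNReal := fun n θ => ENNReal.ofReal (F 0 θ - F n θ)
  have hGm : ∀ n, Measurable (G n) := fun n => by
    have := ((hFc 0).sub (hFc n)).measurable
    exact ENNReal.measurable_ofReal.comp this
  have hGmono : Monotone G := by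
    intro m n hmn θ
    apply ENNReal.ofReal_le_ofReal
    have := hFa θ hmn
    simp only at this
    linarith
  have hlint : ∫⁻ θ, (⨆ n, G n θ) ∂μ ≤ ENNReal.ofReal (2 * Real.pi * ((f 0 c).re - (u c).toReal)) := by
    rw [lintegral_iSup hGm hGmono]
    apply iSup_le
    intro n
    rw [show (∫⁻ a, G n a ∂μ) = ∫⁻ a, ENNReal.ofReal ((F 0 - F n) a) ∂μ from rfl,
      ← ofReal_integral_eq_lintegral_ofReal ((hFi 0).sub (hFi n))]
    · apply ENNReal.ofReal_le_ofReal
      rw [integral_sub' (hFi 0) (hFi n), hFint, hFint]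
      have := hc n
      nlinarith
    · filter_upwards with θ
      have := hFa θ (Nat.zero_le n)
      simp only at this
      simp; linarith
  have hfin : ∀ᵐ θ ∂μ, (⨆ n, G n θ) < ⊤ := by
    apply ae_lt_top (Measurable.iSup hGm)
    exact (hlint.trans_lt ENNReal.ofReal_lt_top).ne
  have hnb : ∀ᵐ θ ∂μ, u (circleMap c r θ) ≠ ⊥ := by
    filter_upwards [hfin] with θ hθ hb
    obtain ⟨n, hn⟩ := hlim _ (hs θ) (F 0 θ - (⨆ n, G n θ).toReal - 1) (by rw [hb]; exact EReal.bot_lt_coe _)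
    have h1 : G n θ ≤ ⨆ n, G n θ := le_iSup (fun n => G n θ) n
    have h2 := ENNReal.toReal_mono hθ.ne h1
    have h3 : F 0 θ - F n θ ≤ (G n θ).toReal := by
      rw [ENNReal.toReal_ofReal']; exact le_max_left _ _
    simp only [F] at h3 hn h2
    linarith
  have htend : ∀ᵐ θ ∂μ, Tendsto (fun n => F n θ) atTop (𝓝 (u (circleMap c r θ)).toReal) := by
    filter_upwards [hnb] with θ hθ
    have hcoe := EReal.coe_toReal (htop _ (hs θ)) hθ
    apply tendsto_order.2 ⟨?_, ?_⟩
    · intro a ha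
      filter_upwards with n
      have := hge n _ (hs θ)
      rw [← hcoe] at this
      exact ha.trans_le (EReal.coe_le_coe_iff.1 this)
    · intro a ha
      obtain ⟨n, hn⟩ := hlim _ (hs θ) a (by rw [← hcoe]; exact EReal.coe_lt_coe_iff.2 ha)
      filter_upwards [eventually_ge_atTop n] with m hm
      exact (hFa θ hm).trans_lt hn
  have hInt : Integrable (fun θ => (u (circleMap c r θ)).toReal) μ := by
    have hD : Integrable (fun θ => F 0 θ - (u (circleMap c r θ)).toReal) μ := by
      have hmeas : AEStronglyMeasurable (fun θ => F 0 θ - (u (circleMap c r θ)).toReal) μ := by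
        apply aestronglyMeasurable_of_tendsto_ae atTop (f := fun n θ => F 0 θ - F n θ)
        · intro n; exact ((hFi 0).sub (hFi n)).1
        · filter_upwards [htend] with θ hθ
          exact hθ.const_sub _
      refine ⟨hmeas, ?_⟩
      rw [hasFiniteIntegral_iff_enorm]
      refine lt_of_le_of_lt (lintegral_mono_ae ?_) (hlint.trans_lt ENNReal.ofReal_lt_top)
      filter_upwards [htend] with θ hθ
      have h0 : 0 ≤ F 0 θ - (u (circleMap c r θ)).toReal := by
        have := (hFa θ).le_of_tendsto hθ 0
        linarith
      rw [Real.enorm_eq_ofReal h0]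
      have ht2 : Tendsto (fun n => G n θ) atTop (𝓝 (ENNReal.ofReal (F 0 θ - (u (circleMap c r θ)).toReal))) :=
        ENNReal.tendsto_ofReal (hθ.const_sub _)
      exact le_of_tendsto' ht2 (fun n => le_iSup (fun n => G n θ) n)
    have := (hFi 0).sub hD
    refine this.congr ?_
    filter_upwards with θ
    simp
  have hlimI := integral_tendsto_of_tendsto_of_antitone hFi hInt (by filter_upwards with θ using hFa θ) htend
  unfold circleAvg
  rw [if_pos ⟨(intervalIntegrable_iff_integrableOn_Ioc_of_le hpi.le).2 hInt, hnb⟩]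
  rw [← EReal.coe_toReal hctop hbot]
  apply EReal.coe_le_coe_iff.2
  rw [le_div_iff₀ hpi, intervalIntegral.integral_of_le hpi.le]
  apply ge_of_tendsto' hlimI
  intro n
  rw [hFint, mul_comm]
  have := hc n
  gcongr

end SH13

namespace SH13

lemma add_coe_le_iff {x : EReal} {a b : ℝ} : x + (a : EReal) ≤ (b : EReal) ↔ x ≤ ((b - a : ℝ) : EReal) := by
  induction x with
  | bot => simp
  | coe y =>
    rw [← EReal.coe_add, EReal.coe_le_coe_iff, EReal.coe_le_coe_iff]
    constructor <;> intro h <;> linarith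
  | top =>
    rw [EReal.top_add_coe, top_le_iff, top_le_iff]
    exact ⟨fun h => absurd h (EReal.coe_ne_top _), fun h => absurd h (EReal.coe_ne_top _)⟩

lemma lt_add_coe_iff {x : EReal} {a b : ℝ} : (b : EReal) < x + (a : EReal) ↔ ((b - a : ℝ) : EReal) < x := by
  rw [← not_le, add_coe_le_iff, not_le]

lemma le_of_forall_eps {x : EReal} {a : ℝ} (h : ∀ ε : ℝ, 0 < ε → x ≤ ((a + ε : ℝ) : EReal)) :
    x ≤ (a : EReal) := by
  by_contra hc
  push Not at hc
  obtain ⟨b, hb1, hb2⟩ := EReal.lt_iff_exists_real_btwn.1 hc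
  have h1 : a < b := EReal.coe_lt_coe_iff.1 hb1
  have := h (b - a) (by linarith)
  rw [add_sub_cancel] at this
  exact absurd hb2 (not_lt.2 this)

/-- Dini type lemma -/
lemma dini {C : Set ℂ} (hC : IsCompact C) {w : ℕ → ℂ → EReal}
    (hw : ∀ n, UpperSemicontinuousOn (w n) C) (ha : ∀ x ∈ C, Antitone (fun n => w n x))
    {g : ℂ → ℝ} (hg : Continuous g) (hlt : ∀ x ∈ C, ∃ n, w n x < (g x : EReal)) :
    ∃ n, ∀ m, n ≤ m → ∀ x ∈ C, w m x < (g x : EReal) := by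
  have key : ∃ n, ∀ x ∈ C, w n x < (g x : EReal) := by
    refine hC.induction_on (p := fun s => ∃ n, ∀ x ∈ s ∩ C, w n x < (g x : EReal)) ?_ ?_ ?_ ?_ |>.imp
      (fun n hn x hx => hn x ⟨hx, hx⟩)
    · exact ⟨0, by simp⟩
    · rintro s t hst ⟨n, hn⟩
      exact ⟨n, fun x hx => hn x ⟨hst hx.1, hx.2⟩⟩
    · rintro s t ⟨n, hn⟩ ⟨m, hm⟩
      refine ⟨max n m, ?_⟩
      rintro x ⟨hx | hx, hxC⟩
      · exact lt_of_le_of_lt (ha x hxC (le_max_left n m)) (hn x ⟨hx, hxC⟩)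
      · exact lt_of_le_of_lt (ha x hxC (le_max_right n m)) (hm x ⟨hx, hxC⟩)
    · intro x hx
      obtain ⟨n, hn⟩ := hlt x hx
      obtain ⟨b, hb1, hb2⟩ := EReal.lt_iff_exists_real_btwn.1 hn
      have h1 := hw n x hx b hb1
      have h2 : ∀ᶠ y in 𝓝[C] x, b < g y :=
        (hg.continuousAt.eventually (lt_mem_nhds (EReal.coe_lt_coe_iff.1 hb2))).filter_mono nhdsWithin_le_nhds
      refine ⟨_, h1.and h2, n, ?_⟩
      rintro y ⟨⟨hy1, hy2⟩, -⟩
      exact lt_trans hy1 (EReal.coe_lt_coe_iff.2 hy2)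
  obtain ⟨n, hn⟩ := key
  exact ⟨n, fun m hm x hx => lt_of_le_of_lt (ha x hx hm) (hn x hx)⟩

lemma usc_coe {g : ℂ → ℝ} (hg : Continuous g) (S : Set ℂ) :
    UpperSemicontinuousOn (fun x => (g x : EReal)) S :=
  ((continuous_coe_real_ereal.comp hg).upperSemicontinuous).upperSemicontinuousOn S

lemma usc_add {u v : ℂ → EReal} {S : Set ℂ} (hu : UpperSemicontinuousOn u S)
    (hv : UpperSemicontinuousOn v S) (hut : ∀ x ∈ S, u x ≠ ⊤) (hvt : ∀ x ∈ S, v x ≠ ⊤) :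
    UpperSemicontinuousOn (fun x => u x + v x) S :=
  hu.add' hv (fun x hx => EReal.continuousAt_add (Or.inl (hut x hx)) (Or.inr (hvt x hx)))

lemma max_principle {c : ℂ} {r : ℝ} (hr : 0 < r) {u : ℂ → EReal}
    (hu : UpperSemicontinuousOn u (closedBall c r)) (htop : ∀ x ∈ closedBall c r, u x ≠ ⊤)
    (hloc : ∀ x ∈ ball c r, ∃ s > 0, closedBall x s ⊆ closedBall c r ∧ SM u x s)
    {f : ℂ → ℂ} (hf : Differentiable ℂ f) (hle : ∀ x ∈ sphere c r, u x ≤ ((f x).re : ℝ)) :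
    ∀ x ∈ closedBall c r, u x ≤ ((f x).re : ℝ) := by
  intro x1 hx1
  by_contra hcon
  push Not at hcon
  obtain ⟨b', hb1, hb2⟩ := EReal.lt_iff_exists_real_btwn.1 hcon
  have hb1' := EReal.coe_lt_coe_iff.1 hb1
  set b := b' - (f x1).re with hb
  have hbpos : 0 < b := by linarith
  set ε := b / (2 * r ^ 2) with hε
  have hεpos : 0 < ε := by positivity
  let e : ℂ → ℝ := fun x => -(f x).re + ε * ‖x - c‖ ^ 2
  have he : Continuous e := by
    have := hf.continuous
    fun_prop
  obtain ⟨x0, hx0, hmax⟩ := (usc_add hu (usc_coe he _) htop (fun _ _ => EReal.coe_ne_top _)).exists_isMaxOn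
    ⟨c, mem_closedBall_self hr.le⟩ (isCompact_closedBall c r)
  have hbig : (b : EReal) < u x0 + (e x0 : ℝ) := by
    refine lt_of_lt_of_le ?_ (hmax hx1)
    simp only
    rw [lt_add_coe_iff]
    refine lt_of_le_of_lt ?_ hb2
    apply EReal.coe_le_coe_iff.2
    simp only [e]
    have : 0 ≤ ε * ‖x1 - c‖ ^ 2 := by positivity
    linarith
  have hx0b : x0 ∈ ball c r := by
    by_contra hn
    have hs : x0 ∈ sphere c r := by
      rw [mem_sphere]; rw [mem_ball, not_lt] at hn; rw [mem_closedBall] at hx0; exact le_antisymm hx0 hn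
    have h1 := hle x0 hs
    rw [lt_add_coe_iff] at hbig
    have h2 := EReal.coe_lt_coe_iff.1 (hbig.trans_le h1)
    simp only [e] at h2
    rw [mem_sphere, dist_eq_norm] at hs
    rw [hs] at h2
    have : ε * r ^ 2 = b / 2 := by rw [hε]; field_simp
    linarith
  have hbot : u x0 ≠ ⊥ := by
    intro h; rw [h] at hbig; simp at hbig
  obtain ⟨U, hU⟩ : ∃ U : ℝ, u x0 = U := ⟨(u x0).toReal, (EReal.coe_toReal (htop _ hx0) hbot).symm⟩
  obtain ⟨s, hs, hsub, hSM⟩ := hloc x0 hx0b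
  let g : ℂ → ℂ := fun x => f x + ((U + e x0 - ε * (‖x0 - c‖ ^ 2 + s ^ 2) : ℝ) : ℂ)
    - 2 * ε * ((starRingEnd ℂ) (x0 - c) * (x - x0))
  have hg : Differentiable ℂ g := by fun_prop
  have h3 := hSM g hg (by
    intro x hx
    have hxm := hmax (hsub (sphere_subset_closedBall hx))
    simp only [mem_ofPred_eq] at hxm
    rw [hU, ← EReal.coe_add, add_coe_le_iff] at hxm
    refine hxm.trans (EReal.coe_le_coe_iff.2 ?_)
    rw [mem_sphere, dist_eq_norm] at hx
    have h4 : ‖x - c‖ ^ 2 = ‖x0 - c‖ ^ 2 + s ^ 2 + 2 * ((starRingEnd ℂ) (x0 - c) * (x - x0)).re := by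
      rw [← hx]
      simp only [Complex.sq_norm, Complex.normSq_apply, Complex.mul_re, Complex.conj_re, Complex.conj_im, Complex.sub_re, Complex.sub_im]
      ring
    have h5 : (g x).re = (f x).re + (U + e x0 - ε * (‖x0 - c‖ ^ 2 + s ^ 2)) - 2 * ε * ((starRingEnd ℂ) (x0 - c) * (x - x0)).re := by
      simp only [g]
      have : (2 * (ε:ℂ) * ((starRingEnd ℂ) (x0 - c) * (x - x0))).re = 2 * ε * ((starRingEnd ℂ) (x0 - c) * (x - x0)).re := by
        rw [← Complex.re_ofReal_mul]; push_cast; rfl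
      rw [Complex.sub_re, Complex.add_re, Complex.ofReal_re, this]
    rw [h5]
    simp only [e]
    rw [h4]
    apply le_of_eq; ring)
  rw [hU] at h3
  have h3 := EReal.coe_le_coe_iff.1 h3
  simp only [g, sub_self, mul_zero, sub_zero, Complex.add_re, Complex.ofReal_re, e] at h3
  have : 0 < ε * s ^ 2 := by positivity
  linarith

/-- Subharmonic without the nontriviality condition. -/
def SHOn (u : ℂ → EReal) (Ω : Set ℂ) : Prop :=
  (∀ z ∈ Ω, u z ≠ ⊤) ∧ UpperSemicontinuousOn u Ω ∧
  ∀ c r, 0 < r → closedBall c r ⊆ Ω → SM u c r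

lemma SHOn.mono {u : ℂ → EReal} {Ω Ω' : Set ℂ} (h : SHOn u Ω) (hs : Ω' ⊆ Ω) : SHOn u Ω' :=
  ⟨fun z hz => h.1 z (hs hz), h.2.1.mono hs, fun c r hr hc => h.2.2 c r hr (hc.trans hs)⟩

lemma SHOn.le_on_ball {u : ℂ → EReal} {Ω : Set ℂ} (h : SHOn u Ω) {c : ℂ} {r : ℝ} (hr : 0 < r)
    (hc : closedBall c r ⊆ Ω) {f : ℂ → ℂ} (hf : Differentiable ℂ f)
    (hle : ∀ x ∈ sphere c r, u x ≤ ((f x).re : ℝ)) :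
    ∀ x ∈ closedBall c r, u x ≤ ((f x).re : ℝ) := by
  refine max_principle hr (h.2.1.mono hc) (fun x hx => h.1 x (hc hx)) ?_ hf hle
  intro x hx
  rw [mem_ball] at hx
  have hsub : closedBall x (r - dist x c) ⊆ closedBall c r :=
    closedBall_subset_closedBall' (by linarith)
  exact ⟨r - dist x c, by linarith, hsub, h.2.2 _ _ (by linarith) (hsub.trans hc)⟩

lemma SHOn.of_local {u : ℂ → EReal} {Ω : Set ℂ} (h1 : ∀ z ∈ Ω, u z ≠ ⊤)
    (h2 : UpperSemicontinuousOn u Ω)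
    (h3 : ∀ x ∈ Ω, ∃ ρ > 0, ∀ s, 0 < s → s < ρ → SM u x s) : SHOn u Ω := by
  refine ⟨h1, h2, fun c r hr hc f hf hle => ?_⟩
  refine max_principle hr (h2.mono hc) (fun x hx => h1 x (hc hx)) ?_ hf hle c (mem_closedBall_self hr.le)
  intro x hx
  obtain ⟨ρ, hρ, hSM⟩ := h3 x (hc (ball_subset_closedBall hx))
  rw [mem_ball] at hx
  have hd : 0 < r - dist x c := by linarith
  refine ⟨min (ρ / 2) (r - dist x c), lt_min (by linarith) hd, ?_, hSM _ (lt_min (by linarith) hd) ?_⟩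
  · apply closedBall_subset_closedBall'
    have := min_le_right (ρ / 2) (r - dist x c)
    linarith
  · exact (min_le_left _ _).trans_lt (by linarith)

lemma SHOn.of_nhds {u : ℂ → EReal} {Ω : Set ℂ}
    (h : ∀ x ∈ Ω, ∃ N, IsOpen N ∧ x ∈ N ∧ ∃ v, SHOn v N ∧ EqOn u v N) : SHOn u Ω := by
  refine SHOn.of_local ?_ ?_ ?_
  · intro x hx
    obtain ⟨N, -, hxN, v, hv, he⟩ := h x hx
    rw [he hxN]; exact hv.1 x hxN
  · intro x hx
    obtain ⟨N, hN, hxN, v, hv, he⟩ := h x hx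
    intro a ha
    rw [he hxN] at ha
    have := hv.2.1 x hxN a ha
    rw [hN.nhdsWithin_eq hxN] at this
    apply Filter.Eventually.filter_mono nhdsWithin_le_nhds
    filter_upwards [this, hN.mem_nhds hxN] with y hy hyN
    rw [he hyN]; exact hy
  · intro x hx
    obtain ⟨N, hN, hxN, v, hv, he⟩ := h x hx
    obtain ⟨ρ, hρ, hb⟩ := Metric.isOpen_iff.1 hN x hxN
    refine ⟨ρ, hρ, fun s hs hsρ f hf hle => ?_⟩
    have hsub : closedBall x s ⊆ N := (closedBall_subset_ball hsρ).trans hb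
    rw [he hxN]
    apply hv.2.2 x s hs hsub f hf
    intro y hy
    rw [← he (hsub (sphere_subset_closedBall hy))]
    exact hle y hy

lemma SHOn.congr {u v : ℂ → EReal} {Ω : Set ℂ} (hΩ : IsOpen Ω) (h : SHOn v Ω) (he : EqOn u v Ω) : SHOn u Ω :=
  SHOn.of_nhds fun _ hx => ⟨Ω, hΩ, hx, v, h, he⟩

lemma SHOn.max {u v : ℂ → EReal} {Ω : Set ℂ} (hu : SHOn u Ω) (hv : SHOn v Ω) :
    SHOn (fun x => max (u x) (v x)) Ω := by
  refine ⟨fun z hz => (max_lt (lt_top_iff_ne_top.2 (hu.1 z hz)) (lt_top_iff_ne_top.2 (hv.1 z hz))).ne,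
    hu.2.1.sup hv.2.1, fun c r hr hc f hf hle => max_le ?_ ?_⟩
  · exact hu.2.2 c r hr hc f hf fun x hx => (le_max_left _ _).trans (hle x hx)
  · exact hv.2.2 c r hr hc f hf fun x hx => (le_max_right _ _).trans (hle x hx)

lemma SHOn.re {f : ℂ → ℂ} (hf : Differentiable ℂ f) (Ω : Set ℂ) :
    SHOn (fun x => ((f x).re : EReal)) Ω := by
  refine ⟨fun _ _ => EReal.coe_ne_top _, usc_coe (Complex.continuous_re.comp hf.continuous) _, ?_⟩
  intro c r hr hc g hg hle
  apply EReal.coe_le_coe_iff.2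
  exact re_max hf hg hr (fun x hx => EReal.coe_le_coe_iff.1 (hle x hx)) c (mem_closedBall_self hr.le)

lemma SHOn.const (a : ℝ) (Ω : Set ℂ) : SHOn (fun _ => (a : EReal)) Ω := by
  have := SHOn.re (f := fun _ => (a : ℂ)) (by fun_prop) Ω
  simpa using this

lemma SHOn.add {u v : ℂ → EReal} {Ω : Set ℂ} (hu : SHOn u Ω) (hv : SHOn v Ω) :
    SHOn (fun x => u x + v x) Ω := by
  refine ⟨fun z hz => EReal.add_ne_top (hu.1 z hz) (hv.1 z hz),
    usc_add hu.2.1 hv.2.1 hu.1 hv.1, fun c r hr hc f hf hle => ?_⟩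
  have hsc : sphere c r ⊆ Ω := sphere_subset_closedBall.trans hc
  obtain ⟨p, hp, hpa, hpge, hplim⟩ := entire_approx hr (hu.2.1.mono hsc) (fun x hx => hu.1 x (hsc hx))
  obtain ⟨q, hq, hqa, hqge, hqlim⟩ := entire_approx hr (hv.2.1.mono hsc) (fun x hx => hv.1 x (hsc hx))
  apply le_of_forall_eps
  intro ε hε
  obtain ⟨n, hn⟩ := dini (isCompact_sphere c r) (w := fun n x => (((p n x).re + (q n x).re : ℝ) : EReal))
    (g := fun x => (f x).re + ε)
    (fun n => usc_coe ((Complex.continuous_re.comp (hp n).continuous).add (Complex.continuous_re.comp (hq n).continuous)) _)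
    (fun x hx m n hmn => EReal.coe_le_coe_iff.2
      (add_le_add (hpa x (sphere_subset_closedBall hx) hmn) (hqa x (sphere_subset_closedBall hx) hmn)))
    ((Complex.continuous_re.comp hf.continuous).add continuous_const) (by
      intro x hx
      have h1 : u x + v x ≤ (((f x).re : ℝ) : EReal) := hle x hx
      have : ∃ a b : ℝ, u x < a ∧ v x < b ∧ a + b = (f x).re + ε := by
        have hut := hu.1 x (hsc hx)
        have hvt := hv.1 x (hsc hx)
        revert h1 hut hvt
        generalize u x = U
        generalize v x = V
        intro h1 hut hvt
        induction U with
        | top => exact absurd rfl hut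
        | bot =>
          induction V with
          | top => exact absurd rfl hvt
          | bot => exact ⟨0, (f x).re + ε, EReal.bot_lt_coe _, EReal.bot_lt_coe _, by ring⟩
          | coe b => exact ⟨(f x).re + ε - (b + 1), b + 1, EReal.bot_lt_coe _, EReal.coe_lt_coe_iff.2 (by linarith), by ring⟩
        | coe a =>
          induction V with
          | top => exact absurd rfl hvt
          | bot => exact ⟨a + 1, (f x).re + ε - (a + 1), EReal.coe_lt_coe_iff.2 (by linarith), EReal.bot_lt_coe _, by ring⟩
          | coe b =>
            rw [← EReal.coe_add] at h1
            have h1 := EReal.coe_le_coe_iff.1 h1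
            exact ⟨a + ε/2, (f x).re + ε - (a + ε/2), EReal.coe_lt_coe_iff.2 (by linarith), EReal.coe_lt_coe_iff.2 (by linarith), by ring⟩
      obtain ⟨a, b, ha, hb, hab⟩ := this
      obtain ⟨m, hm⟩ := hplim x hx a ha
      obtain ⟨k, hk⟩ := hqlim x hx b hb
      refine ⟨Max.max m k, EReal.coe_lt_coe_iff.2 ?_⟩
      have h5 : (p (Max.max m k) x).re ≤ (p m x).re := hpa x (sphere_subset_closedBall hx) (le_max_left m k)
      have h6 : (q (Max.max m k) x).re ≤ (q k x).re := hqa x (sphere_subset_closedBall hx) (le_max_right m k)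
      linarith)
  have h1 := hu.2.2 c r hr hc (p n) (hp n) (hpge n)
  have h2 := hv.2.2 c r hr hc (q n) (hq n) (hqge n)
  refine (add_le_add h1 h2).trans ?_
  rw [← EReal.coe_add]
  apply EReal.coe_le_coe_iff.2
  have := re_max (f := fun x => p n x + q n x) (g := fun x => f x + ε) ((hp n).add (hq n)) (hf.add_const _) hr
    (by
      intro x hx
      have := EReal.coe_lt_coe_iff.1 (hn n le_rfl x hx)
      simp; linarith) c (mem_closedBall_self hr.le)
  simpa using this

lemma SHOn.iInf {w : ℕ → ℂ → EReal} {Ω : Set ℂ} (hw : ∀ n, SHOn (w n) Ω)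
    (ha : ∀ x ∈ Ω, Antitone (fun n => w n x)) : SHOn (fun x => ⨅ n, w n x) Ω := by
  refine ⟨fun z hz => ne_top_of_le_ne_top ((hw 0).1 z hz) (iInf_le _ 0),
    upperSemicontinuousOn_iInf (fun n => (hw n).2.1), fun c r hr hc f hf hle => ?_⟩
  have hsc : sphere c r ⊆ Ω := sphere_subset_closedBall.trans hc
  apply le_of_forall_eps
  intro ε hε
  obtain ⟨n, hn⟩ := dini (isCompact_sphere c r) (w := w)
    (g := fun x => (f x).re + ε) (fun n => (hw n).2.1.mono hsc) (fun x hx => ha x (hsc hx))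
    ((Complex.continuous_re.comp hf.continuous).add continuous_const) (by
      intro x hx
      have : (⨅ n, w n x) < (((f x).re + ε : ℝ) : EReal) :=
        lt_of_le_of_lt (hle x hx) (EReal.coe_lt_coe_iff.2 (by linarith))
      exact iInf_lt_iff.1 this)
  refine (iInf_le _ n).trans ?_
  have := (hw n).2.2 c r hr hc (fun x => f x + ε) (hf.add_const _) (by
    intro x hx
    have := (hn n le_rfl x hx).le
    simpa using this)
  simpa using this

lemma SHOn.smul {u : ℂ → EReal} {Ω : Set ℂ} (hu : SHOn u Ω) {t : ℝ} (ht : 0 < t) :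
    SHOn (fun x => (t : EReal) * u x) Ω := by
  have key : ∀ (x : EReal) (a : ℝ), (t : EReal) * x < a ↔ x < ((a / t : ℝ) : EReal) := by
    intro x a
    induction x with
    | bot => rw [EReal.coe_mul_bot_of_pos ht]; simp [EReal.bot_lt_coe]
    | coe y =>
      rw [← EReal.coe_mul, EReal.coe_lt_coe_iff, EReal.coe_lt_coe_iff, lt_div_iff₀ ht, mul_comm]
    | top => rw [EReal.coe_mul_top_of_pos ht]; simp
  have key2 : ∀ (x : EReal) (a : ℝ), (t : EReal) * x ≤ a ↔ x ≤ ((a / t : ℝ) : EReal) := by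
    intro x a
    induction x with
    | bot => rw [EReal.coe_mul_bot_of_pos ht]; simp
    | coe y =>
      rw [← EReal.coe_mul, EReal.coe_le_coe_iff, EReal.coe_le_coe_iff, le_div_iff₀ ht, mul_comm]
    | top => rw [EReal.coe_mul_top_of_pos ht]; simp
  refine ⟨?_, ?_, ?_⟩
  · intro z hz
    have := hu.1 z hz
    show (t : EReal) * u z ≠ ⊤
    revert this
    generalize u z = y
    intro this
    induction y with
    | bot => rw [EReal.coe_mul_bot_of_pos ht]; simp
    | coe y => rw [← EReal.coe_mul]; exact EReal.coe_ne_top _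
    | top => exact absurd rfl this
  · intro x hx a ha
    obtain ⟨b, hb1, hb2⟩ := EReal.lt_iff_exists_real_btwn.1 ha
    have := hu.2.1 x hx _ ((key _ _).1 hb1)
    filter_upwards [this] with y hy
    exact ((key _ _).2 hy).trans hb2
  · intro c r hr hc f hf hle
    rw [key2]
    have := hu.2.2 c r hr hc (fun x => f x / t) (hf.div_const _) (by
      intro x hx
      have := (key2 _ _).1 (hle x hx)
      rwa [Complex.div_ofReal_re])
    rwa [Complex.div_ofReal_re] at this

lemma SHOn.of_PSHOn {u : ℂ → EReal} {Ω : Set ℂ} (h : PSHOn u Ω) : SHOn u Ω := by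
  refine ⟨h.1, h.2.1, fun c r hr hc => ?_⟩
  apply SM_of_circleAvg hr (fun x hx => h.1 x (hc (sphere_subset_closedBall hx)))
  have := h.2.2.2 0 1 c r hr (by intro l hl; simpa using hc hl)
  simpa using this

lemma SHOn.toPSHOn {u : ℂ → EReal} {Ω : Set ℂ} (h : SHOn u Ω)
    (hb : ∀ z ∈ Ω, ∃ w ∈ connectedComponentIn Ω z, u w ≠ ⊥) : PSHOn u Ω := by
  refine ⟨h.1, h.2.1, hb, ?_⟩
  intro a b c r hr hsub
  have hs : ∀ l ∈ sphere c r, a + l • b ∈ Ω := fun l hl => hsub l (sphere_subset_closedBall hl)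
  apply circleAvg_of_SM (u := fun l => u (a + l • b)) hr
  · apply UpperSemicontinuousOn.comp h.2.1
    · exact Continuous.continuousOn (by fun_prop)
    · exact hs
  · intro x hx; exact h.1 _ (hs x hx)
  · intro f hf hle
    by_cases hb0 : b = 0
    · subst hb0
      simp only [smul_zero, add_zero] at hle ⊢
      have hm := SHOn.re hf univ
      by_cases hbot : u a = ⊥
      · rw [hbot]; exact bot_le
      have hta : u a ≠ ⊤ := by
        have := h.1 (a + c • (0:ℂ)) (hsub c (mem_closedBall_self hr.le))
        simpa using this
      rw [← EReal.coe_toReal hta hbot] at hle ⊢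
      apply EReal.coe_le_coe_iff.2
      have := re_max (f := fun _ => ((u a).toReal : ℂ)) (by fun_prop) hf hr (by
        intro x hx; have := EReal.coe_le_coe_iff.1 (hle x hx); simpa using this) c (mem_closedBall_self hr.le)
      simpa using this
    · have hbn : 0 < ‖b‖ := norm_pos_iff.2 hb0
      have inv : ∀ x, a + ((x - a) / b) • b = x := by
        intro x; rw [smul_eq_mul]; field_simp; ring
      have hd : ∀ x, dist ((x - a) / b) c * ‖b‖ = dist x (a + c • b) := by
        intro x
        rw [dist_eq_norm, dist_eq_norm, ← norm_mul, smul_eq_mul]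
        congr 1; field_simp; ring
      have := h.2.2 (a + c • b) (r * ‖b‖) (by positivity) (by
        intro x hx
        have := hsub ((x - a) / b) (by
          rw [mem_closedBall] at hx ⊢
          rw [← hd] at hx
          exact le_of_mul_le_mul_right hx hbn)
        rwa [inv] at this) (fun x => f ((x - a) / b)) (by fun_prop) (by
        intro x hx
        have := hle ((x - a) / b) (by
          rw [mem_sphere] at hx ⊢
          rw [← hd] at hx
          exact mul_right_cancel₀ hbn.ne' hx)
        simpa only [inv] using this)
      have e : (a + c • b - a) / b = c := by rw [smul_eq_mul]; field_simp; ring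
      simp only [e] at this
      exact this

lemma SHOn.toPSHOn' {u : ℂ → EReal} {Ω : Set ℂ} (h : SHOn u Ω)
    (hb : ∀ z ∈ Ω, u z ≠ ⊥) : PSHOn u Ω :=
  h.toPSHOn fun z hz => ⟨z, mem_connectedComponentIn hz, hb z hz⟩

end SH13

namespace SH13

lemma poisson {u : ℂ → EReal} {Ω : Set ℂ} (hΩ : IsOpen Ω) (hu : SHOn u Ω) {c : ℂ} {r : ℝ}
    (hr : 0 < r) (hc : closedBall c r ⊆ Ω) :
    ∃ q : ℂ → EReal, SHOn q Ω ∧ (∀ x, x ∉ ball c r → q x = u x) ∧ (∀ x ∈ Ω, u x ≤ q x) ∧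
      ∃ f : ℕ → ℂ → ℂ, (∀ n, Differentiable ℂ (f n)) ∧
        (∀ x ∈ closedBall c r, Antitone fun n => (f n x).re) ∧
        ∀ x ∈ closedBall c r, q x = ⨅ n, (((f n x).re : ℝ) : EReal) := by
  classical
  have hsc : sphere c r ⊆ Ω := sphere_subset_closedBall.trans hc
  obtain ⟨f, hf, hfa, hfge, hflim⟩ := entire_approx hr (hu.2.1.mono hsc) (fun x hx => hu.1 x (hsc hx))
  let I : ℂ → EReal := fun x => ⨅ n, (((f n x).re : ℝ) : EReal)
  let q : ℂ → EReal := fun x => if x ∈ ball c r then I x else u x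
  have hqb : ∀ x ∈ ball c r, q x = I x := fun x hx => if_pos hx
  have hqn : ∀ x, x ∉ ball c r → q x = u x := fun x hx => if_neg hx
  have hqc : ∀ x ∈ closedBall c r, q x = I x := by
    intro x hx
    by_cases hb : x ∈ ball c r
    · exact hqb x hb
    rw [hqn x hb]
    have hs : x ∈ sphere c r := by
      rw [mem_sphere]; rw [mem_ball, not_lt] at hb; rw [mem_closedBall] at hx; exact le_antisymm hx hb
    apply le_antisymm
    · exact le_iInf fun n => hfge n x hs
    · apply le_of_not_gt
      intro hlt
      obtain ⟨a, ha1, ha2⟩ := EReal.lt_iff_exists_real_btwn.1 hlt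
      obtain ⟨n, hn⟩ := hflim x hs a ha1
      have : I x ≤ ((f n x).re : ℝ) := iInf_le _ n
      exact absurd (ha2.trans_le this) (not_lt.2 (EReal.coe_le_coe_iff.2 hn.le))
  have huq : ∀ x ∈ Ω, u x ≤ q x := by
    intro x hx
    by_cases hb : x ∈ ball c r
    · rw [hqb x hb]
      exact le_iInf fun n => hu.le_on_ball hr hc (hf n) (hfge n) x (ball_subset_closedBall hb)
    · rw [hqn x hb]
  have hIsh : SHOn I (ball c r) := SHOn.iInf (fun n => SHOn.re (hf n) _)
    (fun x hx m n hmn => EReal.coe_le_coe_iff.2 (hfa x (ball_subset_closedBall hx) hmn))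
  refine ⟨q, ?_, hqn, huq, f, hf, hfa, hqc⟩
  refine SHOn.of_local ?_ ?_ ?_
  · intro z hz
    by_cases hb : z ∈ ball c r
    · rw [hqb z hb]; exact hIsh.1 z hb
    · rw [hqn z hb]; exact hu.1 z hz
  · intro x hx a ha
    by_cases hb : x ∈ closedBall c r
    · have h1 := hu.2.1 x hx a ((huq x hx).trans_lt ha)
      rw [hqc x hb] at ha
      obtain ⟨n, hn⟩ := iInf_lt_iff.1 ha
      have h2 : ∀ᶠ y in 𝓝[Ω] x, (((f n y).re : ℝ) : EReal) < a :=
        ((continuous_coe_real_ereal.comp (Complex.continuous_re.comp (hf n).continuous)).continuousAt.eventually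
          (gt_mem_nhds hn)).filter_mono nhdsWithin_le_nhds
      filter_upwards [h1, h2] with y hy1 hy2
      by_cases hyb : y ∈ ball c r
      · rw [hqb y hyb]; exact (iInf_le _ n).trans_lt hy2
      · rw [hqn y hyb]; exact hy1
    · have hxb : x ∉ ball c r := fun h => hb (ball_subset_closedBall h)
      rw [hqn x hxb] at ha
      have h1 := hu.2.1 x hx a ha
      have h2 : ∀ᶠ y in 𝓝[Ω] x, y ∈ (closedBall c r)ᶜ :=
        nhdsWithin_le_nhds (isClosed_closedBall.isOpen_compl.mem_nhds hb)
      filter_upwards [h1, h2] with y hy1 hy2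
      rw [hqn y (fun h => hy2 (ball_subset_closedBall h))]; exact hy1
  · intro x hx
    by_cases hb : x ∈ ball c r
    · obtain ⟨ρ, hρ, hsub⟩ := Metric.isOpen_iff.1 isOpen_ball x hb
      refine ⟨ρ, hρ, fun s hs hsρ g hg hle => ?_⟩
      have hsub' : closedBall x s ⊆ ball c r := (closedBall_subset_ball hsρ).trans hsub
      rw [hqb x hb]
      apply hIsh.2.2 x s hs hsub' g hg
      intro y hy
      rw [← hqb y (hsub' (sphere_subset_closedBall hy))]
      exact hle y hy
    · obtain ⟨ρ, hρ, hsub⟩ := Metric.isOpen_iff.1 hΩ x hx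
      refine ⟨ρ, hρ, fun s hs hsρ g hg hle => ?_⟩
      have hsub' : closedBall x s ⊆ Ω := (closedBall_subset_ball hsρ).trans hsub
      rw [hqn x hb]
      apply hu.2.2 x s hs hsub' g hg
      intro y hy
      exact (huq y (hsub' (sphere_subset_closedBall hy))).trans (hle y hy)

/-- Lower bounds pass to decreasing limits of harmonic functions. -/
lemma poisson_ge {c : ℂ} {r : ℝ} (hr : 0 < r) {q : ℂ → EReal} {f : ℕ → ℂ → ℂ}
    (hf : ∀ n, Differentiable ℂ (f n))
    (hq : ∀ x ∈ closedBall c r, q x = ⨅ n, (((f n x).re : ℝ) : EReal)) {g : ℂ → ℂ}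
    (hg : Differentiable ℂ g) (hle : ∀ x ∈ sphere c r, (((g x).re : ℝ) : EReal) ≤ q x) :
    ∀ x ∈ closedBall c r, (((g x).re : ℝ) : EReal) ≤ q x := by
  intro x hx
  rw [hq x hx]
  refine le_iInf fun n => EReal.coe_le_coe_iff.2 ?_
  refine re_max hg (hf n) hr (fun y hy => EReal.coe_le_coe_iff.1 ?_) x hx
  refine (hle y hy).trans ?_
  rw [hq y (sphere_subset_closedBall hy)]
  exact iInf_le _ n

/-- Harnack for nonpositive decreasing limits of harmonic functions. -/
lemma poisson_harnack {c : ℂ} {r : ℝ} (hr : 0 < r) {q : ℂ → EReal} {f : ℕ → ℂ → ℂ}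
    (hf : ∀ n, Differentiable ℂ (f n)) (hfa : ∀ x ∈ closedBall c r, Antitone fun n => (f n x).re)
    (hq : ∀ x ∈ closedBall c r, q x = ⨅ n, (((f n x).re : ℝ) : EReal))
    (h0 : ∀ x ∈ sphere c r, q x ≤ 0) {w : ℂ} (hw : w ∈ ball c r) (a : ℝ) :
    (q c ≤ ((-a : ℝ) : EReal) → q w ≤ ((-((r - ‖w - c‖) / (r + ‖w - c‖) * a) : ℝ) : EReal)) ∧
    (((-a : ℝ) : EReal) ≤ q c → ((-((r + ‖w - c‖) / (r - ‖w - c‖) * a) : ℝ) : EReal) ≤ q w) ∧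
    (((-a : ℝ) : EReal) ≤ q w → ((-((r + ‖w - c‖) / (r - ‖w - c‖) * a) : ℝ) : EReal) ≤ q c) := by
  have hd : ‖w - c‖ < r := by rwa [mem_ball, dist_eq_norm] at hw
  have hd0 : 0 ≤ ‖w - c‖ := norm_nonneg _
  set d := ‖w - c‖
  set κ := (r - d) / (r + d) with hκ
  have hκpos : 0 < κ := div_pos (by linarith) (by linarith)
  have hκ1 : κ ≤ 1 := (div_le_one (by linarith)).2 (by linarith)
  have hκi : (r + d) / (r - d) = κ⁻¹ := by rw [hκ, inv_div]
  rw [hκi]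
  have hcc : c ∈ closedBall c r := mem_closedBall_self hr.le
  have hwc : w ∈ closedBall c r := ball_subset_closedBall hw
  -- main estimate
  have key : ∀ δ > 0, ∃ N, ∀ n, N ≤ n → κ * (δ - (f n c).re) ≤ δ - (f n w).re ∧
      κ * (δ - (f n w).re) ≤ δ - (f n c).re := by
    intro δ hδ
    obtain ⟨N, hN⟩ := dini (isCompact_sphere c r) (w := fun n x => (((f n x).re : ℝ) : EReal))
      (g := fun _ => δ) (fun n => usc_coe (Complex.continuous_re.comp (hf n).continuous) _)
      (fun x hx m n hmn => EReal.coe_le_coe_iff.2 (hfa x (sphere_subset_closedBall hx) hmn))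
      continuous_const (by
        intro x hx
        have h1 := h0 x hx
        rw [hq x (sphere_subset_closedBall hx)] at h1
        exact iInf_lt_iff.1 (h1.trans_lt (EReal.coe_pos.2 hδ)))
    refine ⟨N, fun n hn => ?_⟩
    have h2 := harnack (f := fun x => (δ : ℂ) - f n x) ((differentiable_const _).sub (hf n)) hw (by
      intro x hx
      have := EReal.coe_lt_coe_iff.1 (hN n hn x hx)
      simp; linarith)
    simp only [Complex.sub_re, Complex.ofReal_re] at h2
    refine ⟨h2.1, ?_⟩
    have h3 := h2.2
    change _ ≤ (r + d) / (r - d) * _ at h3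
    rw [hκi] at h3
    calc κ * (δ - (f n w).re) ≤ κ * (κ⁻¹ * (δ - (f n c).re)) := by gcongr
      _ = _ := by field_simp
  refine ⟨?_, ?_, ?_⟩
  · intro h
    apply le_of_forall_eps
    intro ε hε
    obtain ⟨N, hN⟩ := key (ε / 2) (by positivity)
    rw [hq c hcc] at h
    have h4 : (⨅ n, (((f n c).re : ℝ) : EReal)) < ((-a + ε / 2 : ℝ) : EReal) :=
      h.trans_lt (EReal.coe_lt_coe_iff.2 (by linarith))
    obtain ⟨m, hm⟩ := iInf_lt_iff.1 h4
    have hm := EReal.coe_lt_coe_iff.1 hm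
    have h5 := (hN (max N m) (le_max_left _ _)).1
    have h6 : (f (max N m) c).re ≤ (f m c).re := hfa c hcc (le_max_right N m)
    rw [hq w hwc]
    refine (iInf_le _ (max N m)).trans (EReal.coe_le_coe_iff.2 ?_)
    have h7 : κ * (a) ≤ κ * (ε / 2 - (f (max N m) c).re) := by gcongr; linarith
    linarith
  · intro h
    rw [hq w hwc]
    refine le_iInf fun m => ?_
    rw [hq c hcc] at h
    apply EReal.coe_le_coe_iff.2
    apply le_of_forall_pos_le_add
    intro ε hε
    obtain ⟨N, hN⟩ := key (κ * ε) (by positivity)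
    have h1 := (hN (max N m) (le_max_left _ _)).2
    have h2 := EReal.coe_le_coe_iff.1 (h.trans (iInf_le _ (max N m)))
    have h6 : (f (max N m) w).re ≤ (f m w).re := hfa w hwc (le_max_right N m)
    have h7 : κ * (κ * ε - (f (max N m) w).re) ≤ κ * ε + a := by linarith
    have h8 : κ * ε - (f (max N m) w).re ≤ κ⁻¹ * (κ * ε + a) := by
      rw [inv_mul_eq_div, le_div_iff₀ hκpos]; linarith
    have h9 : κ⁻¹ * (κ * ε + a) = ε + κ⁻¹ * a := by field_simp
    have : 0 < κ * ε := by positivity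
    linarith
  · intro h
    rw [hq c hcc]
    refine le_iInf fun m => ?_
    rw [hq w hwc] at h
    apply EReal.coe_le_coe_iff.2
    apply le_of_forall_pos_le_add
    intro ε hε
    obtain ⟨N, hN⟩ := key (κ * ε) (by positivity)
    have h1 := (hN (max N m) (le_max_left _ _)).1
    have h2 := EReal.coe_le_coe_iff.1 (h.trans (iInf_le _ (max N m)))
    have h6 : (f (max N m) c).re ≤ (f m c).re := hfa c hcc (le_max_right N m)
    have h7 : κ * (κ * ε - (f (max N m) c).re) ≤ κ * ε + a := by linarith
    have h8 : κ * ε - (f (max N m) c).re ≤ κ⁻¹ * (κ * ε + a) := by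
      rw [inv_mul_eq_div, le_div_iff₀ hκpos]; linarith
    have h9 : κ⁻¹ * (κ * ε + a) = ε + κ⁻¹ * a := by field_simp
    have : 0 < κ * ε := by positivity
    linarith

lemma SHOn.le_const_on_ball {u : ℂ → EReal} {Ω : Set ℂ} (h : SHOn u Ω) {c : ℂ} {r : ℝ} (hr : 0 < r)
    (hc : closedBall c r ⊆ Ω) {a : ℝ} (hle : ∀ x ∈ sphere c r, u x ≤ (a : EReal)) :
    ∀ x ∈ closedBall c r, u x ≤ (a : EReal) := by
  have := h.le_on_ball hr hc (f := fun _ => (a : ℂ)) (by fun_prop) (by simpa using hle)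
  simpa using this

end SH13

namespace SH13

lemma psh_ne_bot_dense {p : ℂ → EReal} (hp : PSHOn p univ) (z : ℂ) {s : ℝ} (hs : 0 < s) :
    ∃ x ∈ ball z s, p x ≠ ⊥ := by
  obtain ⟨w, -, hw⟩ := hp.2.2.1 0 (mem_univ _)
  by_contra hcon
  push Not at hcon
  have hzw : z ≠ w := by
    rintro rfl
    exact hw (hcon z (mem_ball_self hs))
  set r := dist z w with hr
  have hrpos : 0 < r := dist_pos.2 hzw
  have h1 : p w ≤ circleAvg p w r := by
    have := hp.2.2.2 0 1 w r hrpos (by simp)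
    simpa using this
  unfold circleAvg at h1
  split_ifs at h1 with hi
  · obtain ⟨-, hae⟩ := hi
    rw [ae_restrict_iff' measurableSet_Ioc] at hae
    have hz : z ∈ circleMap w r '' Ioc 0 (2 * Real.pi) := by
      rw [image_circleMap_Ioc, abs_of_pos hrpos, mem_sphere]
    obtain ⟨θ, hθ, hθz⟩ := hz
    have hopen : IsOpen (circleMap w r ⁻¹' ball z s) := isOpen_ball.preimage (continuous_circleMap w r)
    have hmem : θ ∈ circleMap w r ⁻¹' ball z s := by
      rw [mem_preimage, hθz]; exact mem_ball_self hs
    obtain ⟨η, hη, hsub⟩ := Metric.isOpen_iff.1 hopen θ hmem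
    have hlt : max 0 (θ - η) < θ := max_lt hθ.1 (by linarith)
    have hpos : 0 < volume (Ioo (max 0 (θ - η)) θ) := by
      rw [Real.volume_Ioo]; simpa using hlt
    refine hpos.ne' (measure_mono_null ?_ hae)
    intro t ht
    simp only [mem_compl_iff, mem_ofPred_eq]
    intro h
    have ht1 := (max_lt_iff.1 ht.1)
    refine h ⟨ht1.1, ht.2.le.trans hθ.2⟩ (hcon _ (hsub ?_))
    rw [mem_ball, Real.dist_eq, abs_lt]
    constructor <;> linarith [ht1.2, ht.2]
  · exact hw (le_bot_iff.1 h1)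

lemma polar_fun {K L : Set ℂ} (hK : PolarSet K) (hLK : L ⊆ K) (hL : IsClosed L) {z : ℂ} (hz : z ∉ L)
    (M : ℝ) {ε : ℝ} (hε : 0 < ε) :
    ∃ p : ℂ → EReal, SHOn p univ ∧ (∀ x ∈ L, p x = ⊥) ∧ (∀ x ∈ closedBall 0 M, p x ≤ 0) ∧
      ((-ε : ℝ) : EReal) ≤ p z := by
  obtain ⟨p0, hp0, hp0K⟩ := hK
  obtain ⟨r', hr', hsub⟩ := Metric.isOpen_iff.1 hL.isOpen_compl z hz
  set r := r' / 2 with hrdef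
  have hr : 0 < r := by positivity
  have hrL : closedBall z r ⊆ Lᶜ := (closedBall_subset_ball (by linarith)).trans hsub
  set M' := max M (‖z‖ + r)
  have hzM : closedBall z r ⊆ closedBall 0 M' := by
    apply closedBall_subset_closedBall'
    rw [dist_zero_right]
    have := le_max_right M (‖z‖ + r)
    linarith
  have hp : SHOn p0 univ := SHOn.of_PSHOn hp0
  obtain ⟨x0, hx0, hmax⟩ := (hp.2.1.mono (subset_univ (closedBall 0 M'))).exists_isMaxOn
    ⟨z, hzM (mem_closedBall_self hr.le)⟩ (isCompact_closedBall _ _)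
  obtain ⟨b, hb1, -⟩ := EReal.lt_iff_exists_real_btwn.1 (lt_top_iff_ne_top.2 (hp.1 x0 (mem_univ _)))
  set p1 : ℂ → EReal := fun x => p0 x + ((-b : ℝ) : EReal) with hp1
  have hp1s : SHOn p1 univ := hp.add (SHOn.const (-b) univ)
  have hp1le : ∀ x ∈ closedBall 0 M', p1 x ≤ 0 := by
    intro x hx
    have h1 : p0 x ≤ p0 x0 := hmax hx
    have : p1 x ≤ ((0 : ℝ) : EReal) := by
      rw [hp1]; simp only
      rw [add_coe_le_iff]
      refine (h1.trans hb1.le).trans (EReal.coe_le_coe_iff.2 (by linarith))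
    simpa using this
  obtain ⟨w, hw, hwbot⟩ := psh_ne_bot_dense hp0 z hr
  obtain ⟨q, hq, hqn, hqge, f, hf, hfa, hqf⟩ := poisson isOpen_univ hp1s hr (subset_univ (closedBall z r))
  have hqle : ∀ x ∈ closedBall 0 M', q x ≤ 0 := by
    intro x hx
    by_cases hb : x ∈ ball z r
    · have := hq.le_const_on_ball hr (subset_univ _) (a := 0) (fun y hy => by
        rw [hqn y (by rw [mem_ball, mem_sphere.1 hy]; exact lt_irrefl _)]
        simpa using hp1le y (hzM (sphere_subset_closedBall hy))) x (ball_subset_closedBall hb)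
      simpa using this
    · rw [hqn x hb]; exact hp1le x hx
  have hwa : ∃ a : ℝ, ((-a : ℝ) : EReal) ≤ q w := by
    refine ⟨-((p0 w).toReal + -b), ?_⟩
    refine le_trans ?_ (hqge w (mem_univ _))
    rw [neg_neg, hp1, EReal.coe_add, EReal.coe_toReal (hp.1 w (mem_univ _)) hwbot]
  obtain ⟨a, ha⟩ := hwa
  have hqz := (poisson_harnack hr hf hfa hqf (fun x hx => hqle x (hzM (sphere_subset_closedBall hx))) hw a).2.2 ha
  set A := (r + ‖w - z‖) / (r - ‖w - z‖) * a
  set t := ε / (|A| + 1) with ht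
  have htpos : 0 < t := by positivity
  refine ⟨fun x => (t : EReal) * q x, hq.smul htpos, ?_, ?_, ?_⟩
  · intro x hx
    have h1 : x ∉ ball z r := fun h => hrL (ball_subset_closedBall h) hx
    simp only [hqn x h1, hp1, hp0K x (hLK hx), EReal.bot_add, EReal.coe_mul_bot_of_pos htpos]
  · intro x hx
    have h1 := hqle x (closedBall_subset_closedBall (le_max_left _ _) hx)
    exact mul_nonpos_of_nonneg_of_nonpos (EReal.coe_nonneg.2 htpos.le) h1
  · calc ((-ε : ℝ) : EReal) ≤ ((t * (-A) : ℝ) : EReal) := by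
          apply EReal.coe_le_coe_iff.2
          have h1 : t * (|A| + 1) = ε := by rw [ht]; field_simp
          have h2 : t * A ≤ t * |A| := by gcongr; exact le_abs_self A
          nlinarith
      _ = (t : EReal) * ((-A : ℝ) : EReal) := by rw [EReal.coe_mul]
      _ ≤ _ := mul_le_mul_of_nonneg_left hqz (EReal.coe_nonneg.2 htpos.le)

end SH13

namespace SH13

lemma coe_m1 : ((-1 : ℝ) : EReal) = -1 := by rw [EReal.coe_neg, EReal.coe_one]

lemma relExt_le {S Ω : Set ℂ} (hΩ : IsOpen Ω) (hS : S ⊆ Ω) {u : ℂ → EReal} (hu : SHOn u Ω)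
    (hm : ∀ x ∈ Ω, -1 ≤ u x) (h0 : ∀ x ∈ Ω, u x ≤ 0) (h1 : ∀ x ∈ S, u x ≤ -1) (z : ℂ) :
    relExtremal z S Ω ≤ - u z := by
  unfold relExtremal
  rw [EReal.neg_le_neg_iff]
  refine le_sSup ⟨u, hu.toPSHOn' ?_, h0, ?_, rfl⟩
  · intro x hx h
    have := hm x hx
    rw [h, le_bot_iff, ← coe_m1] at this
    exact EReal.coe_ne_bot _ this
  · intro w hw
    have hwΩ := hS hw
    rw [insert_eq_of_mem hwΩ]
    refine le_trans ?_ (h1 w hw)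
    apply le_of_forall_gt_imp_ge_of_dense
    intro a ha
    exact limsup_le_of_le (by isBoundedDefault) ((hu.2.1 w hwΩ a ha).mono fun _ h => h.le)

lemma le_relExt {S Ω : Set ℂ} (hS : S ⊆ Ω) {z : ℂ} {b : EReal}
    (h : ∀ u : ℂ → EReal, SHOn u Ω → (∀ x ∈ Ω, -1 ≤ u x) → (∀ x ∈ Ω, u x ≤ 0) →
      (∀ x ∈ S, u x ≤ -1) → u z ≤ -b) : b ≤ relExtremal z S Ω := by
  unfold relExtremal
  rw [EReal.le_neg]
  apply sSup_le
  rintro y ⟨u, hu, h0, h1, rfl⟩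
  have hm : (-1 : EReal) ≤ 0 := by rw [← coe_m1]; exact_mod_cast (by norm_num : (-1:ℝ) ≤ 0)
  refine (le_max_left (u z) (((-1 : ℝ) : EReal))).trans (h (fun x => max (u x) ((-1 : ℝ) : EReal))
    ((SHOn.of_PSHOn hu).max (SHOn.const _ _)) ?_ ?_ ?_)
  · intro x _; rw [coe_m1]; exact le_max_right _ _
  · intro x hx; rw [coe_m1]; exact max_le (h0 x hx) hm
  · intro x hx; rw [coe_m1]
    refine max_le ?_ le_rfl
    refine le_trans ?_ (h1 x hx)
    apply le_limsup_of_frequently_le'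
    intro hc
    have := mem_of_mem_nhdsWithin (mem_insert x Ω) hc
    exact this le_rfl

lemma part1 (D : Set ℂ)
    (hD : IsOpen D) (hDbdd : Bornology.IsBounded D)
    (S : Set ℂ) (hS : S ⊆ D)
    (K : Set ℂ) (hK : K ⊆ frontier D) (hKcpt : IsCompact K) (hKpolar : PolarSet K) :
    (∀ z ∈ D, relExtremal z S D =
      sInf {y : EReal | ∃ U : Set ℂ, IsOpen U ∧ K ⊆ U ∧
        y = relExtremal z S (D ∪ U)}) := by
  classical
  intro z hz
  apply le_antisymm
  · apply le_sInf
    rintro y ⟨U, hU, hKU, rfl⟩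
    apply le_relExt (hS.trans subset_union_left)
    intro u hu hm h0 h1
    rw [EReal.le_neg]
    exact relExt_le hD hS (hu.mono subset_union_left) (fun x hx => hm x (Or.inl hx)) (fun x hx => h0 x (Or.inl hx)) h1 z
  · apply le_relExt hS
    intro u hu hm h0 h1
    rw [EReal.le_neg]
    have hub : u z ≠ ⊥ := by
      intro h
      have := hm z hz
      rw [h, le_bot_iff, ← coe_m1] at this
      exact EReal.coe_ne_bot _ this
    obtain ⟨a, ha⟩ : ∃ a : ℝ, u z = a := ⟨(u z).toReal, (EReal.coe_toReal (hu.1 z hz) hub).symm⟩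
    rw [ha, ← EReal.coe_neg]
    apply le_of_forall_eps
    intro ε hε
    have hzK : z ∉ K := fun h => by
      have := hK h
      rw [hD.frontier_eq] at this
      exact this.2 hz
    obtain ⟨M, hM⟩ := hDbdd.subset_closedBall (0 : ℂ)
    obtain ⟨p, hp, hpK, hp0, hpz⟩ := polar_fun hKpolar subset_rfl hKcpt.isClosed hzK M hε
    set U : Set ℂ := {x | p x < -1} with hUdef
    have hU : IsOpen U := by
      have := hp.2.1
      rw [upperSemicontinuousOn_univ_iff] at this
      exact this.isOpen_preimage (-1)
    have hKU : K ⊆ U := by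
      intro x hx
      rw [hUdef, mem_ofPred_eq, hpK x hx, ← coe_m1]
      exact EReal.bot_lt_coe _
    let w : ℂ → EReal := fun x => max (u x + p x) ((-1 : ℝ) : EReal)
    let v : ℂ → EReal := fun x => if x ∈ D then w x else ((-1 : ℝ) : EReal)
    have hvD : ∀ x ∈ D, v x = w x := fun x hx => if_pos hx
    have hw : SHOn w D := (hu.add (hp.mono (subset_univ _))).max (SHOn.const _ _)
    have hvU : ∀ x ∈ U, v x = ((-1 : ℝ) : EReal) := by
      intro x hx
      by_cases hxD : x ∈ D
      · rw [hvD x hxD]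
        apply max_eq_right
        rw [coe_m1]
        calc u x + p x ≤ 0 + p x := by gcongr; exact h0 x hxD
          _ = p x := zero_add _
          _ ≤ -1 := le_of_lt hx
      · exact if_neg hxD
    have hv : SHOn v (D ∪ U) := by
      apply SHOn.of_nhds
      rintro x (hx | hx)
      · exact ⟨D, hD, hx, w, hw, hvD⟩
      · exact ⟨U, hU, hx, _, SHOn.const (-1) U, hvU⟩
    have hm1 : (((-1 : ℝ) : EReal)) ≤ 0 := by exact_mod_cast (by norm_num : (-1:ℝ) ≤ 0)
    have hwle : ∀ x ∈ D, u x + p x ≤ u x := by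
      intro x hx
      calc u x + p x ≤ u x + 0 := by gcongr; exact hp0 x (hM hx)
        _ = u x := add_zero _
    have h2 := relExt_le (S := S) (hD.union hU) (hS.trans subset_union_left) hv (by
        rintro x (hx | hx)
        · rw [hvD x hx, ← coe_m1]; exact le_max_right _ _
        · rw [hvU x hx, coe_m1]) (by
        rintro x (hx | hx)
        · rw [hvD x hx]; exact max_le ((hwle x hx).trans (h0 x hx)) hm1
        · rw [hvU x hx]; exact hm1) (by
        intro x hx
        rw [hvD x (hS hx), ← coe_m1]
        exact max_le ((hwle x (hS hx)).trans (by rw [coe_m1]; exact h1 x hx)) le_rfl) z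
    refine le_trans (sInf_le ⟨U, hU, hKU, rfl⟩) (h2.trans ?_)
    rw [hvD z hz, EReal.neg_le, ← EReal.coe_neg]
    refine le_trans ?_ (le_max_left _ _)
    rw [ha]
    calc ((-(-a + ε) : ℝ) : EReal) = (a : EReal) + ((-ε : ℝ) : EReal) := by
          rw [← EReal.coe_add]; congr 1; ring
      _ ≤ _ := by gcongr

end SH13

namespace SH13

/-- Competitors for the extremal function of `A` relative to `B`. -/
def Comp (B A : Set ℂ) (u : ℂ → EReal) : Prop :=
  SHOn u B ∧ (∀ x ∈ B, ((-1 : ℝ) : EReal) ≤ u x) ∧ (∀ x ∈ B, u x ≤ 0) ∧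
    ∀ x ∈ A, u x ≤ ((-1 : ℝ) : EReal)

/-- The extremal function. -/
noncomputable def ext (B A : Set ℂ) (x : ℂ) : EReal := ⨅ u : {u : ℂ → EReal // Comp B A u}, -(u.1 x)

lemma m1_le_zero : ((-1 : ℝ) : EReal) ≤ 0 := by exact_mod_cast (by norm_num : (-1:ℝ) ≤ 0)

lemma Comp.m1 (B A : Set ℂ) : Comp B A (fun _ => ((-1 : ℝ) : EReal)) :=
  ⟨SHOn.const _ _, fun _ _ => le_rfl, fun _ _ => m1_le_zero, fun _ _ => le_rfl⟩

lemma Comp.max {B A : Set ℂ} {u v : ℂ → EReal} (hu : Comp B A u) (hv : Comp B A v) :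
    Comp B A (fun x => max (u x) (v x)) :=
  ⟨hu.1.max hv.1, fun x hx => (hu.2.1 x hx).trans (le_max_left _ _),
    fun x hx => max_le (hu.2.2.1 x hx) (hv.2.2.1 x hx),
    fun x hx => max_le (hu.2.2.2 x hx) (hv.2.2.2 x hx)⟩

lemma ext_le {B A : Set ℂ} {u : ℂ → EReal} (hu : Comp B A u) (x : ℂ) : ext B A x ≤ -(u x) :=
  iInf_le (fun u : {u : ℂ → EReal // Comp B A u} => -(u.1 x)) ⟨u, hu⟩

lemma ext_le_one (B A : Set ℂ) (x : ℂ) : ext B A x ≤ ((1 : ℝ) : EReal) := by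
  refine (ext_le (Comp.m1 B A) x).trans ?_
  rw [← EReal.coe_neg, neg_neg]

lemma le_ext {B A : Set ℂ} {x : ℂ} {a : ℝ} (h : ∀ u, Comp B A u → u x ≤ ((-a : ℝ) : EReal)) :
    (a : EReal) ≤ ext B A x := by
  refine le_iInf fun u => ?_
  rw [EReal.le_neg, ← EReal.coe_neg]
  exact h u.1 u.2

lemma ext_nonneg {B A : Set ℂ} {x : ℂ} (hx : x ∈ B) : ((0 : ℝ) : EReal) ≤ ext B A x := by
  apply le_ext
  intro u hu
  simpa using hu.2.2.1 x hx

/-- Poisson modification of a competitor is a competitor. -/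
lemma Comp.poisson {B A : Set ℂ} (hB : IsOpen B) {u : ℂ → EReal} (hu : Comp B A u)
    {c : ℂ} {r : ℝ} (hr : 0 < r) (hc : closedBall c r ⊆ B \ A) :
    ∃ q, Comp B A q ∧ (∀ x, x ∉ ball c r → q x = u x) ∧ (∀ x ∈ B, u x ≤ q x) ∧
      ∃ f : ℕ → ℂ → ℂ, (∀ n, Differentiable ℂ (f n)) ∧
        (∀ x ∈ closedBall c r, Antitone fun n => (f n x).re) ∧
        ∀ x ∈ closedBall c r, q x = ⨅ n, (((f n x).re : ℝ) : EReal) := by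
  have hcB : closedBall c r ⊆ B := hc.trans sdiff_subset
  obtain ⟨q, hq, hqn, hqge, hf⟩ := SH13.poisson hB hu.1 hr hcB
  refine ⟨q, ⟨hq, fun x hx => (hu.2.1 x hx).trans (hqge x hx), ?_, ?_⟩, hqn, hqge, hf⟩
  · intro x hx
    by_cases hb : x ∈ ball c r
    · have := hq.le_const_on_ball hr hcB (a := 0) (fun y hy => by
        rw [hqn y (by rw [mem_ball, mem_sphere.1 hy]; exact lt_irrefl _)]
        simpa using hu.2.2.1 y (hcB (sphere_subset_closedBall hy))) x (ball_subset_closedBall hb)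
      simpa using this
    · rw [hqn x hb]; exact hu.2.2.1 x hx
  · intro x hx
    rw [hqn x (fun h => (hc (ball_subset_closedBall h)).2 hx)]
    exact hu.2.2.2 x hx

lemma ext_local {B A : Set ℂ} (hB : IsOpen B) (hBA : IsOpen (B \ A)) {x : ℂ} (hx : x ∈ B \ A) {b : ℝ}
    (hb : ext B A x < (b : EReal)) :
    ∃ q, Comp B A q ∧ ∀ᶠ y in 𝓝 x, -(q y) < (b : EReal) := by
  obtain ⟨⟨u, hu⟩, hub⟩ := iInf_lt_iff.1 hb
  obtain ⟨r', hr', hsub⟩ := Metric.isOpen_iff.1 hBA x hx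
  set r := r' / 2 with hrdef
  have hr : 0 < r := by positivity
  have hc : closedBall x r ⊆ B \ A := (closedBall_subset_ball (by linarith)).trans hsub
  obtain ⟨q, hq, hqn, hqge, f, hf, hfa, hqf⟩ := hu.poisson hB hr hc
  obtain ⟨a, ha1, ha2⟩ := EReal.lt_iff_exists_real_btwn.1 hub
  have ha2 := EReal.coe_lt_coe_iff.1 ha2
  have hqx : ((-a : ℝ) : EReal) ≤ q x := by
    refine le_trans ?_ (hqge x hx.1)
    rw [EReal.coe_neg, EReal.neg_le]
    exact ha1.le
  refine ⟨q, hq, ?_⟩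
  have hcont : ContinuousAt (fun y : ℂ => (r + ‖y - x‖) / (r - ‖y - x‖) * a) x := by
    apply ContinuousAt.mul _ continuousAt_const
    apply ContinuousAt.div (by fun_prop) (by fun_prop)
    simp [hr.ne']
  have h2 : ∀ᶠ y in 𝓝 x, (r + ‖y - x‖) / (r - ‖y - x‖) * a < b := by
    refine hcont.eventually_lt continuousAt_const ?_
    simp only [sub_self, norm_zero, add_zero, sub_zero]
    rwa [div_self hr.ne', one_mul]
  filter_upwards [h2, ball_mem_nhds x hr] with y hy1 hy2
  have h3 := (poisson_harnack hr hf hfa hqf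
    (fun y hy => hq.2.2.1 y (hc (sphere_subset_closedBall hy)).1) hy2 a).2.1 hqx
  refine lt_of_le_of_lt ?_ (EReal.coe_lt_coe_iff.2 hy1)
  rw [EReal.neg_le, ← EReal.coe_neg]
  exact h3

lemma ext_SHOn {B A : Set ℂ} (hB : IsOpen B) (hBA : IsOpen (B \ A)) : SHOn (ext B A) (B \ A) := by
  refine ⟨fun z _ => ne_top_of_le_ne_top (EReal.coe_ne_top _) (ext_le_one B A z), ?_, ?_⟩
  · intro x hx a ha
    obtain ⟨b, hb1, hb2⟩ := EReal.lt_iff_exists_real_btwn.1 ha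
    obtain ⟨q, hq, hev⟩ := ext_local hB hBA hx hb1
    refine Filter.Eventually.filter_mono nhdsWithin_le_nhds ?_
    filter_upwards [hev] with y hy
    exact ((ext_le hq y).trans_lt hy).trans hb2
  · intro c r hr hc f hf hle
    have hfc : Continuous fun x => (f x).re := Complex.continuous_re.comp hf.continuous
    apply le_of_forall_eps
    intro ε hε
    have key : ∃ u, Comp B A u ∧ ∀ x ∈ sphere c r, -(u x) < (((f x).re + ε : ℝ) : EReal) := by
      refine (isCompact_sphere c r).induction_on
        (p := fun s => ∃ u, Comp B A u ∧ ∀ x ∈ s ∩ sphere c r, -(u x) < (((f x).re + ε : ℝ) : EReal))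
        ?_ ?_ ?_ ?_ |>.imp (fun u hu => ⟨hu.1, fun x hx => hu.2 x ⟨hx, hx⟩⟩)
      · exact ⟨_, Comp.m1 B A, by simp⟩
      · rintro s t hst ⟨u, hu, h⟩
        exact ⟨u, hu, fun x hx => h x ⟨hst hx.1, hx.2⟩⟩
      · rintro s t ⟨u, hu, h⟩ ⟨u', hu', h'⟩
        refine ⟨_, hu.max hu', ?_⟩
        rintro x ⟨hx | hx, hxs⟩
        · exact lt_of_le_of_lt (EReal.neg_le_neg_iff.2 (le_max_left _ _)) (h x ⟨hx, hxs⟩)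
        · exact lt_of_le_of_lt (EReal.neg_le_neg_iff.2 (le_max_right _ _)) (h' x ⟨hx, hxs⟩)
      · intro x hx
        have h1 : ext B A x < (((f x).re + ε / 2 : ℝ) : EReal) :=
          (hle x hx).trans_lt (EReal.coe_lt_coe_iff.2 (by linarith))
        obtain ⟨q, hq, hev⟩ := ext_local hB hBA (hc (sphere_subset_closedBall hx)) h1
        have h2 : ∀ᶠ y in 𝓝 x, (f x).re + ε / 2 < (f y).re + ε := by
          have : ∀ᶠ y in 𝓝 x, (f x).re - ε / 2 < (f y).re :=
            hfc.continuousAt.eventually (lt_mem_nhds (by linarith))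
          filter_upwards [this] with y hy
          linarith
        refine ⟨_, nhdsWithin_le_nhds (hev.and h2), q, hq, ?_⟩
        rintro y ⟨⟨hy1, hy2⟩, -⟩
        exact lt_trans hy1 (EReal.coe_lt_coe_iff.2 hy2)
    obtain ⟨u, hu, hu2⟩ := key
    obtain ⟨q, hq, hqn, hqge, g, hg, hga, hqg⟩ := hu.poisson hB hr hc
    have h3 := poisson_ge hr hg hqg (g := fun x => -(f x) - ε) (hf.neg.sub_const _) (by
      intro x hx
      refine le_trans ?_ (hqge x (hc (sphere_subset_closedBall hx)).1)
      have := (hu2 x hx).le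
      rw [EReal.neg_le, ← EReal.coe_neg] at this
      refine le_trans (le_of_eq ?_) this
      congr 1
      simp; ring) c (mem_closedBall_self hr.le)
    refine (ext_le hq c).trans ?_
    rw [EReal.neg_le, ← EReal.coe_neg]
    refine le_trans (le_of_eq ?_) h3
    congr 1
    simp; ring

lemma ext_lower {B A : Set ℂ} (hB : IsOpen B) {z : ℂ} {s : ℝ} (hs : 0 < s) (hc : closedBall z s ⊆ B \ A)
    {a : ℝ} (ha : 0 ≤ a) (h : ∀ u, Comp B A u → u z ≤ ((-a : ℝ) : EReal)) {x : ℂ} (hx : x ∈ ball z (s / 7)) :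
    ((3 / 4 * a : ℝ) : EReal) ≤ ext B A x := by
  apply le_ext
  intro u hu
  obtain ⟨q, hq, hqn, hqge, f, hf, hfa, hqf⟩ := hu.poisson hB hs hc
  have hxs : x ∈ ball z s := ball_subset_ball (by linarith) hx
  have h1 := (poisson_harnack hs hf hfa hqf
    (fun y hy => hq.2.2.1 y (hc (sphere_subset_closedBall hy)).1) hxs a).1 (h q hq)
  refine ((hqge x (hc (ball_subset_closedBall hxs)).1).trans h1).trans (EReal.coe_le_coe_iff.2 ?_)
  rw [mem_ball, dist_eq_norm] at hx
  have h0 := norm_nonneg (x - z)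
  have : 3 / 4 ≤ (s - ‖x - z‖) / (s + ‖x - z‖) := by
    rw [le_div_iff₀ (by linarith)]; linarith
  have : 3 / 4 * a ≤ (s - ‖x - z‖) / (s + ‖x - z‖) * a := by gcongr
  linarith

lemma logmax_SHOn (z : ℂ) {r : ℝ} (hr : 0 < r) :
    SHOn (fun x => ((Real.log (max ‖x - z‖ r) : ℝ) : EReal)) univ := by
  have hpos : ∀ x : ℂ, 0 < max ‖x - z‖ r := fun x => lt_max_of_lt_right hr
  refine ⟨fun _ _ => EReal.coe_ne_top _, usc_coe ?_ _, ?_⟩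
  · apply Continuous.log (by fun_prop)
    intro x; exact (hpos x).ne'
  · intro c s hs _ f hf hle
    apply EReal.coe_le_coe_iff.2
    rw [Real.log_le_iff_le_exp (hpos c)]
    have hle' : ∀ x ∈ sphere c s, max ‖x - z‖ r ≤ Real.exp (f x).re := by
      intro x hx
      rw [← Real.log_le_iff_le_exp (hpos x)]
      exact EReal.coe_le_coe_iff.1 (hle x hx)
    have key : ∀ g : ℂ → ℂ, Differentiable ℂ g → (∀ x ∈ sphere c s, ‖g x‖ ≤ Real.exp (f x).re) →
        ‖g c‖ ≤ Real.exp (f c).re := by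
      intro g hg hgle
      have h1 := Complex.norm_le_of_forall_mem_frontier_norm_le (f := fun x => g x * Complex.exp (-f x))
        (U := ball c s) isBounded_ball (hg.mul (Complex.differentiable_exp.comp hf.neg)).diffContOnCl (C := 1) (by
          intro x hx
          rw [frontier_ball c hs.ne'] at hx
          rw [norm_mul, Complex.norm_exp, Complex.neg_re, Real.exp_neg]
          exact mul_inv_le_one_of_le₀ (hgle x hx) (Real.exp_pos _).le) (subset_closure (mem_ball_self hs))
      rw [norm_mul, Complex.norm_exp, Complex.neg_re, Real.exp_neg, mul_inv_le_iff₀ (Real.exp_pos _), one_mul] at h1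
      exact h1
    apply max_le
    · exact key (fun x => x - z) (by fun_prop) fun x hx => (le_max_left _ _).trans (hle' x hx)
    · have := key (fun _ => (r : ℂ)) (by fun_prop) fun x hx => by
        rw [Complex.norm_real, Real.norm_of_nonneg hr.le]
        exact (le_max_right _ _).trans (hle' x hx)
      rwa [Complex.norm_real, Real.norm_of_nonneg hr.le] at this

lemma ext_upper {z : ℂ} {R r : ℝ} (hr : 0 < r) (hrR : r < R) {A : Set ℂ} (hA : A ⊆ ball z r) {x : ℂ}
    (hx : r ≤ ‖x - z‖) :
    ext (ball z R) A x ≤ ((Real.log (R / ‖x - z‖) / Real.log (R / r) : ℝ) : EReal) := by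
  have hR : 0 < R := hr.trans hrR
  set ℓ := Real.log (R / r) with hℓ
  have hℓpos : 0 < ℓ := Real.log_pos (by rwa [one_lt_div hr])
  have hℓ2 : ℓ = Real.log R - Real.log r := Real.log_div hR.ne' hr.ne'
  let t : ℂ → EReal := fun x => ((ℓ⁻¹ : ℝ) : EReal) * (((Real.log (max ‖x - z‖ r) : ℝ) : EReal) + ((-Real.log R : ℝ) : EReal))
  have htv : ∀ x, t x = ((ℓ⁻¹ * (Real.log (max ‖x - z‖ r) - Real.log R) : ℝ) : EReal) := by
    intro x
    simp only [t]
    rw [← EReal.coe_add, ← EReal.coe_mul]; rfl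
  have ht : SHOn t univ := ((logmax_SHOn z hr).add (SHOn.const _ _)).smul (inv_pos.2 hℓpos)
  have hcomp : Comp (ball z R) A t := by
    refine ⟨ht.mono (subset_univ _), ?_, ?_, ?_⟩
    · intro y _
      rw [htv]
      apply EReal.coe_le_coe_iff.2
      have : Real.log r ≤ Real.log (max ‖y - z‖ r) := Real.log_le_log hr (le_max_right _ _)
      rw [inv_mul_eq_div, le_div_iff₀ hℓpos]
      linarith
    · intro y hy
      rw [htv, ← EReal.coe_zero]
      apply EReal.coe_le_coe_iff.2
      rw [mem_ball, dist_eq_norm] at hy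
      have : Real.log (max ‖y - z‖ r) ≤ Real.log R :=
        Real.log_le_log (lt_max_of_lt_right hr) (max_le hy.le hrR.le)
      exact mul_nonpos_of_nonneg_of_nonpos (inv_pos.2 hℓpos).le (by linarith)
    · intro y hy
      have hy := hA hy
      rw [mem_ball, dist_eq_norm] at hy
      rw [htv, max_eq_right hy.le]
      apply EReal.coe_le_coe_iff.2
      rw [inv_mul_eq_div, div_le_iff₀ hℓpos]
      linarith
  refine (ext_le hcomp x).trans (le_of_eq ?_)
  rw [htv, ← EReal.coe_neg, max_eq_left hx, Real.log_div hR.ne' (hr.trans_le hx).ne']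
  congr 1
  rw [inv_mul_eq_div]; ring

end SH13

namespace SH13

lemma lower_closed {p : ℂ → EReal} (hp : SHOn p univ) : IsClosed {x | ((-1 : ℝ) : EReal) ≤ p x} := by
  have := hp.2.1
  rw [upperSemicontinuousOn_univ_iff] at this
  exact this.isClosed_preimage _

/-- Lower capacity-type estimate from regularity. -/
lemma claim {F K : Set ℂ} (hF : IsClosed F) (hKc : IsCompact K) (hKp : PolarSet K) {z : ℂ}
    (hthin : ¬ ThinAt F z) {R : ℝ} (hR : 0 < R) :
    ∃ c : ℝ, 0 < c ∧ c ≤ 1 ∧ ∀ r > 0, ∃ A, IsCompact A ∧ A ⊆ F \ K ∧ A ⊆ ball z r ∧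
      ∀ u, Comp (ball z R) A u → u z ≤ ((-c : ℝ) : EReal) := by
  by_contra hcon
  push Not at hcon
  have hc0 : ∀ n : ℕ, 0 < ((1 / 2 : ℝ)) ^ (n + 3) := fun n => by positivity
  have hc1 : ∀ n : ℕ, ((1 / 2 : ℝ)) ^ (n + 3) ≤ 1 := fun n => pow_le_one₀ (by norm_num) (by norm_num)
  choose ρ hρ hA using fun n : ℕ => hcon ((1 / 2 : ℝ) ^ (n + 3)) (hc0 n) (hc1 n)
  -- radii
  let r : ℕ → ℝ := fun n => Nat.rec (min (ρ 0) R / 2) (fun k t => min t (ρ (k + 1)) / 2) n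
  have hr0 : r 0 = min (ρ 0) R / 2 := rfl
  have hrs : ∀ n, r (n + 1) = min (r n) (ρ (n + 1)) / 2 := fun n => rfl
  have hrpos : ∀ n, 0 < r n := by
    intro n
    induction n with
    | zero => rw [hr0]; have := lt_min (hρ 0) hR; linarith
    | succ k ih => rw [hrs]; have := lt_min ih (hρ (k + 1)); linarith
  have hrρ : ∀ n, r n < ρ n := by
    intro n
    cases n with
    | zero => rw [hr0]; have := lt_min (hρ 0) hR; have := min_le_left (ρ 0) R; linarith
    | succ k =>
      rw [hrs]
      have := lt_min (hrpos k) (hρ (k + 1))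
      have := min_le_right (r k) (ρ (k + 1)); linarith
  have hr0R : r 0 < R := by
    rw [hr0]; have := lt_min (hρ 0) hR; have := min_le_right (ρ 0) R; linarith
  have hrhalf : ∀ n, r (n + 1) ≤ r n / 2 := by
    intro n; rw [hrs]; have := min_le_left (r n) (ρ (n + 1)); linarith
  have hrgeo : ∀ n, r n ≤ r 0 * (1 / 2) ^ n := by
    intro n
    induction n with
    | zero => simp
    | succ k ih => have := hrhalf k; rw [pow_succ]; linarith
  have hrle : ∀ n, r n ≤ r 0 := by
    intro n
    refine (hrgeo n).trans ?_
    have : (1 / 2 : ℝ) ^ n ≤ 1 := pow_le_one₀ (by norm_num) (by norm_num)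
    nlinarith [hrpos 0]
  let T : ℕ → Set ℂ := fun n => {x | r (n + 1) ≤ dist x z} ∩ {x | dist x z ≤ r n}
  have hT : ∀ n, IsClosed (T n) := fun n =>
    (isClosed_le continuous_const (by fun_prop)).inter (isClosed_le (by fun_prop) continuous_const)
  have hTball : ∀ n, T n ⊆ closedBall z (r n) := fun n x hx => hx.2
  have hTB : ∀ n, T n ⊆ ball z R := fun n x hx => by
    rw [mem_ball]; exact (hx.2.trans (hrle n)).trans_lt hr0R
  have hTcover : ∀ x, x ≠ z → dist x z ≤ r 0 → ∃ n, x ∈ T n := by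
    intro x hxz hx
    have hd : 0 < dist x z := dist_pos.2 hxz
    have hex : ∃ n, r (n + 1) ≤ dist x z := by
      obtain ⟨n, hn⟩ := exists_pow_lt_of_lt_one (div_pos hd (hrpos 0)) (by norm_num : (1 / 2 : ℝ) < 1)
      refine ⟨n, ?_⟩
      have h1 := hrhalf n
      have h2 := hrgeo n
      rw [lt_div_iff₀ (hrpos 0)] at hn
      have h3 := hrpos n
      linarith
    classical
    refine ⟨Nat.find hex, Nat.find_spec hex, ?_⟩
    rcases hn : Nat.find hex with _ | k
    · exact hx
    · have := Nat.find_min hex (m := k) (by omega)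
      exact (not_le.1 this).le
  have hzT : ∀ n, z ∉ T n := by
    intro n h
    have : r (n + 1) ≤ dist z z := h.1
    rw [dist_self] at this
    linarith [hrpos (n + 1)]
  obtain ⟨M, hM⟩ := (isBounded_ball (x := z) (r := R)).subset_closedBall (0 : ℂ)
  choose p hp hpL hp0 hpz using fun n : ℕ => polar_fun (L := K ∩ T n) hKp inter_subset_left
    (hKc.isClosed.inter (hT n)) (fun h => hzT n h.2) M (hc0 n)
  let A : ℕ → Set ℂ := fun n => F ∩ T n ∩ {x | ((-1 : ℝ) : EReal) ≤ p n x}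
  have hAT : ∀ n, A n ⊆ T n := fun n x hx => hx.1.2
  have hAc : ∀ n, IsCompact (A n) := fun n =>
    (isCompact_closedBall z (r n)).of_isClosed_subset ((hF.inter (hT n)).inter (lower_closed (hp n)))
      ((hAT n).trans (hTball n))
  have hAK : ∀ n, A n ⊆ F \ K := by
    intro n x hx
    refine ⟨hx.1.1, fun hxK => ?_⟩
    have h1 := hpL n x ⟨hxK, hx.1.2⟩
    have h2 : ((-1 : ℝ) : EReal) ≤ p n x := hx.2
    rw [h1, le_bot_iff] at h2
    exact EReal.coe_ne_bot _ h2
  have hAb : ∀ n, A n ⊆ ball z (ρ n) := fun n =>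
    ((hAT n).trans (hTball n)).trans (closedBall_subset_ball (hrρ n))
  choose u hu huz using fun n : ℕ => hA n (A n) (hAc n) (hAK n) (hAb n)
  let w : ℕ → ℂ → EReal := fun n x => u n x + p n x
  have hw : ∀ n, SHOn (w n) (ball z R) := fun n => (hu n).1.add ((hp n).mono (subset_univ _))
  have hw0 : ∀ n, ∀ x ∈ ball z R, w n x ≤ 0 := fun n x hx =>
    add_nonpos ((hu n).2.2.1 x hx) (hp0 n x (hM hx))
  have hwT : ∀ n, ∀ x ∈ F ∩ T n, w n x ≤ ((-1 : ℝ) : EReal) := by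
    intro n x hx
    have hxB := hTB n hx.2
    by_cases h : ((-1 : ℝ) : EReal) ≤ p n x
    · calc w n x ≤ u n x + 0 := by simp only [w]; gcongr; exact hp0 n x (hM hxB)
        _ = u n x := add_zero _
        _ ≤ _ := (hu n).2.2.2 x ⟨hx, h⟩
    · calc w n x ≤ 0 + p n x := by simp only [w]; gcongr; exact (hu n).2.2.1 x hxB
        _ = p n x := zero_add _
        _ ≤ _ := (not_le.1 h).le
  have hwz : ∀ n, ((-((1 / 2) ^ (n + 2)) : ℝ) : EReal) ≤ w n z := by
    intro n
    calc ((-((1 / 2) ^ (n + 2)) : ℝ) : EReal)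
        = ((-((1 / 2) ^ (n + 3)) : ℝ) : EReal) + ((-((1 / 2) ^ (n + 3)) : ℝ) : EReal) := by
          rw [← EReal.coe_add]; congr 1; ring
      _ ≤ _ := add_le_add (huz n).le (hpz n)
  let s : ℕ → ℂ → EReal := fun N x => ∑ n ∈ Finset.range N, w n x
  have hss : ∀ N x, s (N + 1) x = s N x + w N x := fun N x => Finset.sum_range_succ _ _
  have hs0 : ∀ x, s 0 x = 0 := fun x => Finset.sum_range_zero _
  have hssh : ∀ N, SHOn (s N) (ball z R) := by
    intro N
    induction N with
    | zero =>
      have : s 0 = fun _ => ((0 : ℝ) : EReal) := by funext x; rw [hs0]; rfl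
      rw [this]; exact SHOn.const 0 _
    | succ k ih =>
      have : s (k + 1) = fun x => s k x + w k x := by funext x; exact hss k x
      rw [this]; exact ih.add (hw k)
  have hsle : ∀ N, ∀ x ∈ ball z R, s N x ≤ 0 := fun N x hx => Finset.sum_nonpos fun n _ => hw0 n x hx
  have hanti : ∀ x ∈ ball z R, Antitone fun N => s N x := by
    intro x hx
    apply antitone_nat_of_succ_le
    intro N
    rw [hss]
    calc s N x + w N x ≤ s N x + 0 := by gcongr; exact hw0 N x hx
      _ = s N x := add_zero _
  have hsz : ∀ N, ((-(1 / 2 - (1 / 2) ^ (N + 1)) : ℝ) : EReal) ≤ s N z := by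
    intro N
    induction N with
    | zero => rw [hs0, ← EReal.coe_zero]; apply EReal.coe_le_coe_iff.2; norm_num
    | succ k ih =>
      rw [hss]
      calc ((-(1 / 2 - (1 / 2) ^ (k + 1 + 1)) : ℝ) : EReal)
          = ((-(1 / 2 - (1 / 2) ^ (k + 1)) : ℝ) : EReal) + ((-((1 / 2) ^ (k + 2)) : ℝ) : EReal) := by
            rw [← EReal.coe_add]; congr 1; ring
        _ ≤ _ := add_le_add ih (hwz k)
  have hU : SHOn (fun x => ⨅ N, s N x) (ball z R) := SHOn.iInf hssh hanti
  have hUz : ((-(1 / 2) : ℝ) : EReal) ≤ ⨅ N, s N z := by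
    refine le_iInf fun N => le_trans (EReal.coe_le_coe_iff.2 ?_) (hsz N)
    have : (0 : ℝ) < (1 / 2) ^ (N + 1) := by positivity
    linarith
  have hzB : z ∈ ball z R := mem_ball_self hR
  apply hthin
  right
  refine ⟨ball z R, isOpen_ball, hzB, _, hU.toPSHOn ?_, ?_⟩
  · intro y hy
    refine ⟨z, ?_, ?_⟩
    · rw [(convex_ball z R).isPreconnected.connectedComponentIn hy]
      exact hzB
    · intro h
      change (⨅ N, s N z) = ⊥ at h
      rw [h, le_bot_iff] at hUz
      exact EReal.coe_ne_bot _ hUz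
  · have h1 : limsup (fun x => ⨅ N, s N x) (𝓝[F \ {z}] z) ≤ ((-1 : ℝ) : EReal) := by
      apply limsup_le_of_le (by isBoundedDefault)
      have : ∀ᶠ x in 𝓝[F \ {z}] z, x ∈ ball z (r 0) := nhdsWithin_le_nhds (ball_mem_nhds z (hrpos 0))
      filter_upwards [this, self_mem_nhdsWithin] with x hx hxF
      obtain ⟨n, hn⟩ := hTcover x hxF.2 (mem_ball.1 hx).le
      refine (iInf_le _ (n + 1)).trans ?_
      rw [hss]
      calc s n x + w n x ≤ 0 + w n x := by gcongr; exact hsle n x (hTB n hn)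
        _ = w n x := zero_add _
        _ ≤ _ := hwT n x ⟨hxF.1, hn⟩
    exact (h1.trans_lt (EReal.coe_lt_coe_iff.2 (by norm_num))).trans_le hUz

end SH13

namespace SH13

lemma ext_real {B A : Set ℂ} {x : ℂ} (hx : x ∈ B) :
    ∃ η : ℝ, ext B A x = (η : EReal) ∧ 0 ≤ η ∧ η ≤ 1 := by
  have h0 := ext_nonneg (A := A) hx
  have h1 := ext_le_one B A x
  have ht : ext B A x ≠ ⊤ := ne_top_of_le_ne_top (EReal.coe_ne_top _) h1
  have hb : ext B A x ≠ ⊥ := ne_bot_of_le_ne_bot (EReal.coe_ne_bot _) h0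
  refine ⟨(ext B A x).toReal, (EReal.coe_toReal ht hb).symm, ?_, ?_⟩
  · rw [← EReal.coe_le_coe_iff, EReal.coe_toReal ht hb]; exact h0
  · rw [← EReal.coe_le_coe_iff, EReal.coe_toReal ht hb]; exact h1

lemma barrier_step {G : Set ℂ} {z : ℂ} {R c : ℝ} (hR : 0 < R) (hc0 : 0 < c) (hc1 : c ≤ 1)
    (hzG : z ∉ G)
    (hcl : ∀ r > 0, ∃ A, IsCompact A ∧ A ⊆ G ∧ A ⊆ ball z r ∧
      ∀ u, Comp (ball z R) A u → u z ≤ ((-c : ℝ) : EReal)) (n : ℕ) :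
    ∃ A, IsCompact A ∧ A ⊆ G ∧ ∃ v, SHOn v Aᶜ ∧ (∀ x ∈ Aᶜ, ((-1 : ℝ) : EReal) ≤ v x) ∧
      (∀ x ∈ Aᶜ, v x ≤ 0) ∧ (∀ x ∉ ball z R, v x = ((-1 : ℝ) : EReal)) ∧
      ∃ s > 0, ball z s ⊆ Aᶜ ∧ ∀ x ∈ ball z s, ((-((1 - c / 4) ^ n) : ℝ) : EReal) ≤ v x := by
  classical
  induction n with
  | zero =>
    refine ⟨∅, isCompact_empty, empty_subset _, fun _ => ((-1 : ℝ) : EReal), SHOn.const _ _,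
      fun _ _ => le_rfl, fun _ _ => m1_le_zero, fun _ _ => rfl, 1, one_pos, by simp, ?_⟩
    intro x _; rw [pow_zero]
  | succ n ih =>
    obtain ⟨A, hAc, hAG, v, hv, hvm, hv0, hvR, s, hs, hsA, hvs⟩ := ih
    set M : ℝ := (1 - c / 4) ^ n with hM
    have hMpos : 0 < M := by
      have : 0 < 1 - c / 4 := by linarith
      positivity
    set s' := min s R / 2 with hs'
    have hs'pos : 0 < s' := by have := lt_min hs hR; linarith
    have hs's : s' < s := by have := lt_min hs hR; have := min_le_left s R; linarith
    have hs'R : s' < R := by have := lt_min hs hR; have := min_le_right s R; linarith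
    set ℓ := Real.log (R / (s' / 2)) with hℓ
    have hℓpos : 0 < ℓ := Real.log_pos (by rw [one_lt_div (by linarith)]; linarith)
    set r' := R * Real.exp (-(2 * ℓ / c)) with hr'
    have hr'pos : 0 < r' := by positivity
    have hlog : Real.log (R / r') = 2 * ℓ / c := by
      rw [hr', Real.log_div hR.ne' hr'pos.ne', Real.log_mul hR.ne' (Real.exp_pos _).ne', Real.log_exp]
      ring
    have hr's : r' < s' / 2 := by
      have h1 : s' / 2 = R * Real.exp (-ℓ) := by
        rw [Real.exp_neg, hℓ, Real.exp_log (by positivity)]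
        field_simp
      rw [h1, hr']
      apply mul_lt_mul_of_pos_left _ hR
      apply Real.exp_lt_exp.2
      have : 2 * ℓ ≤ 2 * ℓ / c := by rw [le_div_iff₀ hc0]; nlinarith
      linarith
    obtain ⟨A', hA'c, hA'G, hA'r, hA'z⟩ := hcl r' hr'pos
    have hBA : IsOpen (ball z R \ A') := isOpen_ball.sdiff hA'c.isClosed
    have hsh := ext_SHOn (B := ball z R) isOpen_ball hBA
    set h := ext (ball z R) A' with hh
    have hup : ∀ x, s' / 2 ≤ ‖x - z‖ → h x ≤ ((c / 2 : ℝ) : EReal) := by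
      intro x hx
      refine (ext_upper hr'pos (by linarith) hA'r (by linarith)).trans (EReal.coe_le_coe_iff.2 ?_)
      rw [hlog]
      have h1 : Real.log (R / ‖x - z‖) ≤ ℓ := by
        apply Real.log_le_log
        · exact div_pos hR (by linarith)
        · gcongr
      rw [div_le_iff₀ (by positivity)]
      calc _ ≤ ℓ := h1
        _ = _ := by field_simp
    have hzA' : z ∈ ball z R \ A' := ⟨mem_ball_self hR, fun h => hzG (hA'G h)⟩
    obtain ⟨t', ht', htsub⟩ := Metric.isOpen_iff.1 hBA z hzA'
    set t := t' / 2 with ht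
    have htpos : 0 < t := by positivity
    have htc : closedBall z t ⊆ ball z R \ A' := (closedBall_subset_ball (by linarith)).trans htsub
    have hlow : ∀ x ∈ ball z (t / 7), ((3 / 4 * c : ℝ) : EReal) ≤ h x := fun x hx =>
      ext_lower isOpen_ball htpos htc hc0.le hA'z hx
    let g : ℂ → EReal := fun x => (M : EReal) * h x + ((-(M * (1 + c / 2)) : ℝ) : EReal)
    have hg : SHOn g (ball z R \ A') := (hsh.smul hMpos).add (SHOn.const _ _)
    have hgv : ∀ x, ∀ η : ℝ, h x = η → g x = ((M * η - M * (1 + c / 2) : ℝ) : EReal) := by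
      intro x η hη
      simp only [g, hη]
      rw [← EReal.coe_mul, ← EReal.coe_add]; rfl
    let v' : ℂ → EReal := fun x => if x ∈ ball z s' then max (v x) (g x) else v x
    have hv'1 : ∀ x ∈ ball z s', v' x = max (v x) (g x) := fun x hx => if_pos hx
    have hv'2 : ∀ x, s' / 2 ≤ ‖x - z‖ → v' x = v x := by
      intro x hx
      by_cases hxs : x ∈ ball z s'
      · rw [hv'1 x hxs]
        apply max_eq_left
        refine le_trans ?_ (hvs x (ball_subset_ball hs's.le hxs))
        obtain ⟨η, hη, -, -⟩ := ext_real (A := A') (ball_subset_ball hs'R.le hxs)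
        have h1 := hup x hx
        rw [hh, hη] at h1
        have h1 := EReal.coe_le_coe_iff.1 h1
        rw [hgv x η hη]
        apply EReal.coe_le_coe_iff.2
        nlinarith
      · exact if_neg hxs
    have hfar : ∀ x, x ∉ ball z s' → s' / 2 ≤ ‖x - z‖ := by
      intro x hx
      rw [mem_ball, dist_eq_norm, not_lt] at hx
      linarith
    have hball : ball z s' ⊆ Aᶜ := (ball_subset_ball hs's.le).trans hsA
    refine ⟨A ∪ A', hAc.union hA'c, union_subset hAG hA'G, v', ?_, ?_, ?_, ?_, ?_⟩
    · apply SHOn.of_nhds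
      intro x hx
      rw [compl_union] at hx
      by_cases hxs : x ∈ ball z s'
      · refine ⟨ball z s' \ A', isOpen_ball.sdiff hA'c.isClosed, ⟨hxs, hx.2⟩, fun x => max (v x) (g x),
          (hv.mono ?_).max (hg.mono ?_), fun y hy => hv'1 y hy.1⟩
        · exact fun y hy => hball hy.1
        · exact fun y hy => ⟨ball_subset_ball hs'R.le hy.1, hy.2⟩
      · refine ⟨Aᶜ \ closedBall z (s' / 2), hAc.isClosed.isOpen_compl.sdiff isClosed_closedBall, ⟨hx.1, ?_⟩, v,
          hv.mono sdiff_subset, ?_⟩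
        · intro hxc
          rw [mem_closedBall] at hxc
          rw [mem_ball, not_lt] at hxs
          linarith
        · intro y hy
          apply hv'2
          have := hy.2
          rw [mem_closedBall, dist_eq_norm, not_le] at this
          exact this.le
    · intro x hx
      rw [compl_union] at hx
      by_cases hxs : x ∈ ball z s'
      · rw [hv'1 x hxs]; exact (hvm x hx.1).trans (le_max_left _ _)
      · rw [hv'2 x (hfar x hxs)]; exact hvm x hx.1
    · intro x hx
      rw [compl_union] at hx
      by_cases hxs : x ∈ ball z s'
      · rw [hv'1 x hxs]
        refine max_le (hv0 x hx.1) ?_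
        obtain ⟨η, hη, hη0, hη1⟩ := ext_real (A := A') (ball_subset_ball hs'R.le hxs)
        rw [hgv x η hη, ← EReal.coe_zero]
        apply EReal.coe_le_coe_iff.2
        nlinarith
      · rw [hv'2 x (hfar x hxs)]; exact hv0 x hx.1
    · intro x hx
      rw [hv'2 x (hfar x (fun hxs => hx (ball_subset_ball hs'R.le hxs)))]
      exact hvR x hx
    · refine ⟨min s' (t / 7), lt_min hs'pos (by positivity), ?_, ?_⟩
      · intro x hx
        rw [compl_union]
        refine ⟨hball (ball_subset_ball (min_le_left _ _) hx), ?_⟩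
        have : x ∈ closedBall z t := ball_subset_closedBall
          (ball_subset_ball ((min_le_right s' (t / 7)).trans (by linarith)) hx)
        exact (htc this).2
      · intro x hx
        have hxs : x ∈ ball z s' := ball_subset_ball (min_le_left _ _) hx
        rw [hv'1 x hxs]
        refine le_trans ?_ (le_max_right _ _)
        obtain ⟨η, hη, hη0, hη1⟩ := ext_real (A := A') (ball_subset_ball hs'R.le hxs)
        have h1 := hlow x (ball_subset_ball (min_le_right _ _) hx)
        rw [hh, hη] at h1
        have h1 := EReal.coe_le_coe_iff.1 h1
        rw [hgv x η hη]
        apply EReal.coe_le_coe_iff.2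
        rw [pow_succ, ← hM]
        nlinarith

lemma part2 (D : Set ℂ) (hD : IsOpen D) (S : Set ℂ) (hS : S ⊆ D) (hSc : IsClosed S)
    (K : Set ℂ) (hKD : K ⊆ frontier D) (hKcpt : IsCompact K) (hKpolar : PolarSet K) :
    ∀ z ∈ K, RegularBoundaryPoint D z →
      sInf {y : EReal | ∃ U : Set ℂ, IsOpen U ∧ K ⊆ U ∧ y = relExtremal z S (D ∪ U)} = 0 := by
  intro z hz hreg
  have hzD : z ∉ D := by
    have := hKD hz
    rw [hD.frontier_eq] at this
    exact this.2
  obtain ⟨R, hR, hRS⟩ := Metric.isOpen_iff.1 hSc.isOpen_compl z (fun h => hzD (hS h))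
  obtain ⟨c, hc0, hc1, hcl⟩ := claim hD.isClosed_compl hKcpt hKpolar hreg.2 hR
  apply le_antisymm
  · have key : ∀ n : ℕ, sInf {y : EReal | ∃ U : Set ℂ, IsOpen U ∧ K ⊆ U ∧ y = relExtremal z S (D ∪ U)} ≤
        (((1 - c / 4) ^ n : ℝ) : EReal) := by
      intro n
      obtain ⟨A, hAc, hAG, v, hv, hvm, hv0, hvR, s, hs, hsA, hvs⟩ :=
        barrier_step (G := Dᶜ \ K) hR hc0 hc1 (fun h => h.2 hz) hcl n
      have hKA : K ⊆ Aᶜ := fun x hx hxA => (hAG hxA).2 hx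
      have hDA : D ⊆ Aᶜ := fun x hx hxA => (hAG hxA).1 hx
      have hUo : IsOpen Aᶜ := hAc.isClosed.isOpen_compl
      refine le_trans (sInf_le (a := relExtremal z S (D ∪ Aᶜ)) ⟨Aᶜ, hUo, hKA, rfl⟩) ?_
      rw [union_eq_self_of_subset_left hDA]
      refine (relExt_le hUo (hS.trans hDA) hv (by rw [← coe_m1]; exact hvm) hv0 ?_ z).trans ?_
      · intro x hx
        rw [← coe_m1]
        exact (hvR x (fun h => hRS h hx)).le
      · rw [EReal.neg_le, ← EReal.coe_neg]
        exact hvs z (mem_ball_self hs)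
    have : sInf {y : EReal | ∃ U : Set ℂ, IsOpen U ∧ K ⊆ U ∧ y = relExtremal z S (D ∪ U)} ≤ ((0 : ℝ) : EReal) := by
      apply le_of_forall_eps
      intro ε hε
      obtain ⟨n, hn⟩ := exists_pow_lt_of_lt_one hε (by linarith : 1 - c / 4 < 1)
      refine (key n).trans (EReal.coe_le_coe_iff.2 ?_)
      linarith
    simpa using this
  · apply le_sInf
    rintro y ⟨U, hU, hKU, rfl⟩
    apply le_relExt (hS.trans subset_union_left)
    intro u hu hm h0 h1
    rw [neg_zero]
    exact h0 z (Or.inr (hKU hz))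

end SH13

/-- Let `D ⊆ ℂ` be a bounded domain, `S ⊆ D` a closed disc, and
`K ⊆ ∂D` compact polar. Then `ω(z, S, D) = inf { ω(z, S, D ∪ U) : U open ⊇ K }` for
`z ∈ D`; moreover the infimum is `0` at every regular boundary point `z ∈ K` of `D`. -/
theorem statement13 (D : Set ℂ)
    (hD : IsOpen D) (hDconn : IsConnected D) (hDbdd : Bornology.IsBounded D)
    (c : ℂ) (ρ : ℝ) (hρ : 0 < ρ) (hS : Metric.closedBall c ρ ⊆ D)
    (K : Set ℂ) (hK : K ⊆ frontier D) (hKcpt : IsCompact K) (hKpolar : PolarSet K) :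
    (∀ z ∈ D, relExtremal z (Metric.closedBall c ρ) D =
      sInf {y : EReal | ∃ U : Set ℂ, IsOpen U ∧ K ⊆ U ∧
        y = relExtremal z (Metric.closedBall c ρ) (D ∪ U)}) ∧
    ∀ z ∈ K, RegularBoundaryPoint D z →
      sInf {y : EReal | ∃ U : Set ℂ, IsOpen U ∧ K ⊆ U ∧
        y = relExtremal z (Metric.closedBall c ρ) (D ∪ U)} = 0 := by
  exact ⟨SH13.part1 D hD hDbdd _ hS K hK hKcpt hKpolar,
    SH13.part2 D hD _ hS isClosed_closedBall K hK hKcpt hKpolar⟩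
end

section
/- Let D be a domain in ℂ, let B ⊆ D be a closed subset of D, and let z₀ ∈ D be a point at which B is thin. Then there exist a sequence of radii (r_n) ⊆ (0,1) with r_n → 0 and a sequence of points (z_k) ⊆ D \ B with z_k → z₀, such that for every n the closed disc {|z - z₀| ≤ r_n} is contained in D, the circle ∂𝔻_{r_n}(z₀) = {|z - z₀| = r_n} is disjoint from B, and ω(z_k, ∂𝔻_{r_n}(z₀), 𝔻_{r_n}(z₀) \ B) ≥ 1/2 for every n and every k with |z_k - z₀| < r_n. -/
open Set Metric MeasureTheory Filter Topology

/-- Real-valued local subharmonicity. -/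
def LSub (f : ℂ → ℝ) (Ω : Set ℂ) : Prop :=
  UpperSemicontinuousOn f Ω ∧ ∀ c ∈ Ω, ∀ᶠ r in 𝓝[>] (0:ℝ),
    CircleIntegrable f c r ∧ f c ≤ Real.circleAverage f c r

theorem LSub.mono {f : ℂ → ℝ} {Ω Ω' : Set ℂ} (h : LSub f Ω) (hs : Ω' ⊆ Ω) : LSub f Ω' :=
  ⟨h.1.mono hs, fun c hc => h.2 c (hs hc)⟩

theorem LSub.add {f g : ℂ → ℝ} {Ω : Set ℂ} (hf : LSub f Ω) (hg : LSub g Ω) :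
    LSub (fun z => f z + g z) Ω := by
  refine ⟨hf.1.add hg.1, fun c hc => ?_⟩
  filter_upwards [hf.2 c hc, hg.2 c hc] with r h1 h2
  refine ⟨CircleIntegrable.add h1.1 h2.1, ?_⟩
  rw [Real.circleAverage_fun_add h1.1 h2.1]
  linarith [h1.2, h2.2]

theorem LSub.const (a : ℝ) (Ω : Set ℂ) : LSub (fun _ => a) Ω := by
  refine ⟨upperSemicontinuousOn_const, fun c hc => ?_⟩
  refine Eventually.of_forall fun r => ⟨circleIntegrable_const a c r, ?_⟩
  rw [Real.circleAverage_const]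

theorem LSub.cmul {f : ℂ → ℝ} {Ω : Set ℂ} (hf : LSub f Ω) {a : ℝ} (ha : 0 < a) :
    LSub (fun z => a * f z) Ω := by
  refine ⟨fun z hz y hy => ?_, fun c hc => ?_⟩
  · have hy' : a * f z < y := hy
    have : f z < y / a := by rw [lt_div_iff₀ ha]; linarith
    filter_upwards [hf.1 z hz _ this] with w hw
    have hw' : f w < y / a := hw
    rw [lt_div_iff₀ ha] at hw'
    show a * f w < y
    linarith
  · filter_upwards [hf.2 c hc] with r h1
    refine ⟨CircleIntegrable.const_fun_smul (a := a) h1.1, ?_⟩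
    have := Real.circleAverage_fun_smul (a := a) (f := f) (c := c) (R := r)
    simp only [smul_eq_mul] at this
    rw [this]
    exact mul_le_mul_of_nonneg_left h1.2 ha.le

theorem LSub.maxPrinciple {f : ℂ → ℝ} {Ω : Set ℂ} (hΩ : IsOpen Ω) (hb : Bornology.IsBounded Ω)
    (hf : LSub f Ω) (m : ℝ)
    (hm : ∀ ζ ∈ closure Ω, ζ ∉ Ω → ∀ᶠ z in 𝓝[Ω] ζ, f z ≤ m) : ∀ z ∈ Ω, f z ≤ m := by
  intro z1 hz1
  by_contra hlt
  push Not at hlt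
  set T : Set ℂ := {z | z ∈ Ω ∧ f z1 ≤ f z} with hT
  have hTc : IsClosed T := by
    rw [← isOpen_compl_iff, isOpen_iff_mem_nhds]
    intro ζ hζ
    by_cases h1 : ζ ∈ Ω
    · have h2 : f ζ < f z1 := by
        by_contra h; exact hζ ⟨h1, not_lt.1 h⟩
      have h3 := hf.1 ζ h1 _ h2
      rw [hΩ.nhdsWithin_eq h1] at h3
      filter_upwards [h3] with w hw hw2
      exact absurd hw (not_lt.2 hw2.2)
    · by_cases h2 : ζ ∈ closure Ω
      · have h3 := hm ζ h2 h1
        rw [eventually_nhdsWithin_iff] at h3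
        filter_upwards [h3] with w hw hw2
        have := hw hw2.1
        linarith [hw2.2]
      · filter_upwards [isClosed_closure.isOpen_compl.mem_nhds h2] with w hw hw2
        exact hw (subset_closure hw2.1)
  have hTk : IsCompact T := Metric.isCompact_of_isClosed_isBounded hTc (hb.subset fun z hz => hz.1)
  have hTΩ : T ⊆ Ω := fun z hz => hz.1
  obtain ⟨p0, hp0, hmax⟩ := UpperSemicontinuousOn.exists_isMaxOn (s := T) ⟨z1, hz1, le_rfl⟩ hTk (hf.1.mono hTΩ)
  have hA := UpperSemicontinuousOn.isCompact_inter_preimage_Ici (hf.1.mono hTΩ) hTk (f p0)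
  obtain ⟨p, hp, hpre⟩ := hA.exists_isMaxOn ⟨p0, hp0, le_refl (f p0)⟩
    (Complex.continuous_re.continuousOn)
  have hpΩ : p ∈ Ω := hp.1.1
  have hle : ∀ z ∈ Ω, f z ≤ f p := by
    intro z hz
    have h1 : f p0 ≤ f p := hp.2
    by_cases h : f z1 ≤ f z
    · exact (hmax ⟨hz, h⟩ : f z ≤ f p0).trans h1
    · have := hp.1.2
      linarith
  have hlt2 : ∀ z ∈ Ω, p.re < z.re → f z < f p := by
    intro z hz hre
    refine lt_of_le_of_ne (hle z hz) fun h => ?_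
    have h0 : f p0 ≤ f p := hp.2
    have hz2 : z ∈ T ∩ f ⁻¹' Ici (f p0) := ⟨⟨hz, by rw [h]; exact hp.1.2⟩, by
      show f p0 ≤ f z
      rw [h]; exact h0⟩
    have : z.re ≤ p.re := hpre hz2
    linarith
  obtain ⟨R, hR, hball⟩ := Metric.isOpen_iff.1 hΩ p hpΩ
  have hev : ∀ᶠ r in 𝓝[>] (0:ℝ), r ∈ Ioo 0 R := Ioo_mem_nhdsGT hR
  obtain ⟨r, ⟨hint, havg⟩, hr0, hrR⟩ := ((hf.2 p hpΩ).and hev).exists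
  have hin : ∀ θ, circleMap p r θ ∈ Ω := fun θ => hball (by
    rw [Metric.mem_ball, dist_eq_norm]; simp [abs_of_pos hr0, hrR])
  have hpos : 0 < ∫ θ in (0:ℝ)..(2 * Real.pi), (f p - f (circleMap p r θ)) := by
    rw [intervalIntegral.integral_pos_iff_support_of_nonneg_ae]
    · refine ⟨Real.two_pi_pos, ?_⟩
      have hsub : Ioo (0:ℝ) (Real.pi / 2) ⊆
          Function.support (fun θ => f p - f (circleMap p r θ)) ∩ Ioc 0 (2 * Real.pi) := by
        intro θ hθ
        refine ⟨?_, hθ.1, by linarith [hθ.2, Real.pi_pos]⟩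
        have : f (circleMap p r θ) < f p := by
          apply hlt2 _ (hin θ)
          have hc : 0 < Real.cos θ := Real.cos_pos_of_mem_Ioo ⟨by linarith [hθ.1, Real.pi_pos], hθ.2⟩
          have : (circleMap p r θ).re = p.re + r * Real.cos θ := by
            simp [circleMap, Complex.exp_re]
          rw [this]
          have := mul_pos hr0 hc
          linarith
        exact (sub_pos.2 this).ne'
      refine lt_of_lt_of_le ?_ (measure_mono hsub)
      rw [Real.volume_Ioo]
      simp [Real.pi_pos]
    · exact Eventually.of_forall fun θ => sub_nonneg.2 (hle _ (hin θ))
    · exact (intervalIntegrable_const).sub hint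
  rw [intervalIntegral.integral_sub intervalIntegrable_const hint] at hpos
  simp only [intervalIntegral.integral_const, smul_eq_mul, sub_zero] at hpos
  rw [Real.circleAverage_def, smul_eq_mul, ← div_eq_inv_mul, le_div_iff₀ Real.two_pi_pos] at havg
  linarith

theorem circleIntegrable_of_usc {f : ℂ → ℝ} {Ω : Set ℂ} (hf : UpperSemicontinuousOn f Ω) (k : ℝ)
    (hk : ∀ z, k ≤ f z) {c : ℂ} {r : ℝ} (hr : 0 < r) (hs : sphere c r ⊆ Ω) :
    CircleIntegrable f c r := by
  obtain ⟨M, hM⟩ := UpperSemicontinuousOn.bddAbove_of_isCompact (isCompact_sphere c r) (hf.mono hs)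
  have hin : ∀ θ, circleMap c r θ ∈ sphere c r := fun θ => circleMap_mem_sphere c hr.le θ
  have hmeas : Measurable (fun θ => f (circleMap c r θ)) := by
    apply UpperSemicontinuous.measurable
    rw [← upperSemicontinuousOn_univ_iff]
    exact UpperSemicontinuousOn.comp (hf.mono hs) (continuous_circleMap c r).continuousOn
      (fun θ _ => hin θ)
  show IntervalIntegrable _ _ _ _
  refine (intervalIntegrable_const (c := max |k| |M|)).mono_fun hmeas.aestronglyMeasurable ?_
  refine Eventually.of_forall fun θ => ?_
  have h1 := hk (circleMap c r θ)
  have h2 : f (circleMap c r θ) ≤ M := hM ⟨_, hin θ, rfl⟩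
  simp only [Real.norm_eq_abs]
  rw [abs_of_nonneg (le_max_of_le_left (abs_nonneg k) : 0 ≤ max |k| |M|)]
  rw [max_comm]
  have := abs_le_max_abs_abs h1 h2
  rwa [max_comm] at this

theorem PSHOn.lsub {u : ℂ → EReal} {Ω : Set ℂ} (hΩ : IsOpen Ω) (hu : PSHOn u Ω) (k : ℝ) :
    LSub (fun z => (max (u z) (k : EReal)).toReal) Ω := by
  obtain ⟨htop, husc, -, hmean⟩ := hu
  have hcoe : ∀ z ∈ Ω, (((max (u z) (k : EReal)).toReal : ℝ) : EReal) = max (u z) k := by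
    intro z hz
    apply EReal.coe_toReal
    · exact (max_lt (lt_top_iff_ne_top.2 (htop z hz)) (EReal.coe_lt_top k)).ne
    · exact (lt_of_lt_of_le (EReal.bot_lt_coe k) (le_max_right _ _)).ne'
  have husc' : UpperSemicontinuousOn (fun z => (max (u z) (k : EReal)).toReal) Ω := by
    intro z hz y hy
    have hy' : (max (u z) (k : EReal)).toReal < y := hy
    rw [← EReal.coe_lt_coe_iff, hcoe z hz, max_lt_iff] at hy'
    filter_upwards [husc z hz _ hy'.1, self_mem_nhdsWithin] with w hw hwΩ
    show (max (u w) (k : EReal)).toReal < y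
    rw [← EReal.coe_lt_coe_iff, hcoe w hwΩ]
    exact max_lt hw hy'.2
  have hlow : ∀ z ∈ Ω, k ≤ (max (u z) (k : EReal)).toReal := by
    intro z hz
    rw [← EReal.coe_le_coe_iff, hcoe z hz]
    exact le_max_right _ _
  have hlow' : ∀ z, min k 0 ≤ (max (u z) (k : EReal)).toReal := by
    intro z
    by_cases h : u z = ⊤
    · simp [h]
    · refine (min_le_left _ _).trans ?_
      rw [← EReal.coe_le_coe_iff, EReal.coe_toReal]
      · exact le_max_right _ _
      · exact (max_lt (lt_top_iff_ne_top.2 h) (EReal.coe_lt_top k)).ne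
      · exact (lt_of_lt_of_le (EReal.bot_lt_coe k) (le_max_right _ _)).ne'
  refine ⟨husc', fun c hc => ?_⟩
  obtain ⟨R, hR, hball⟩ := Metric.isOpen_iff.1 hΩ c hc
  filter_upwards [(Ioo_mem_nhdsGT hR : Ioo 0 R ∈ 𝓝[>] (0:ℝ))] with r hr
  have hcb : closedBall c r ⊆ Ω := (closedBall_subset_ball hr.2).trans hball
  have hI := circleIntegrable_of_usc husc' _ hlow' hr.1 (sphere_subset_closedBall.trans hcb)
  have hin : ∀ θ, circleMap c r θ ∈ Ω := fun θ =>
    hcb (sphere_subset_closedBall (circleMap_mem_sphere c hr.1.le θ))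
  refine ⟨hI, ?_⟩
  have hm := hmean 0 1 c r hr.1 (fun l hl => by simpa using hcb hl)
  simp only [smul_eq_mul, mul_one, zero_add] at hm
  rw [← EReal.coe_le_coe_iff, hcoe c hc]
  refine max_le (hm.trans ?_) ?_
  · unfold circleAvg
    split_ifs with h
    · rw [EReal.coe_le_coe_iff, Real.circleAverage_def, smul_eq_mul, ← div_eq_inv_mul]
      apply div_le_div_of_nonneg_right _ Real.two_pi_pos.le
      apply intervalIntegral.integral_mono_ae_restrict Real.two_pi_pos.le h.1 hI
      have h2 := h.2
      rw [restrict_Ioc_eq_restrict_Icc] at h2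
      filter_upwards [h2] with θ hθ
      rw [← EReal.coe_le_coe_iff, hcoe _ (hin θ), EReal.coe_toReal (htop _ (hin θ)) hθ]
      exact le_max_left _ _
    · exact bot_le
  · rw [EReal.coe_le_coe_iff]
    have h3 := Real.circleAverage_mono (c := c) (R := r) (circleIntegrable_const k c r) hI
      (fun x hx => hlow x (hcb (sphere_subset_closedBall (by rwa [abs_of_pos hr.1] at hx))))
    rwa [Real.circleAverage_const] at h3

theorem circleAverage_log_norm_sub {a c : ℂ} {r : ℝ} (hr : 0 < r) (h : r < ‖c - a‖) :
    Real.circleAverage (fun z => Real.log ‖z - a‖) c r = Real.log ‖c - a‖ := by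
  apply InnerProductSpace.HarmonicOnNhd.circleAverage_eq
  intro z hz
  apply AnalyticAt.harmonicAt_log_norm
  · fun_prop
  · rw [sub_ne_zero]
    rintro rfl
    rw [abs_of_pos hr, mem_closedBall, dist_eq_norm, norm_sub_rev] at hz
    linarith

theorem lsub_log (a : ℂ) : LSub (fun z => Real.log ‖z - a‖) {a}ᶜ := by
  have hc : ContinuousOn (fun z => Real.log ‖z - a‖) {a}ᶜ := by
    apply ContinuousOn.log (by fun_prop)
    intro z hz
    exact norm_ne_zero_iff.2 (sub_ne_zero.2 hz)
  refine ⟨hc.upperSemicontinuousOn, fun c hc' => ?_⟩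
  have hpos : 0 < ‖c - a‖ := norm_pos_iff.2 (sub_ne_zero.2 hc')
  filter_upwards [(Ioo_mem_nhdsGT hpos : Ioo 0 _ ∈ 𝓝[>] (0:ℝ))] with r hr
  refine ⟨ContinuousOn.circleIntegrable hr.1.le (hc.mono ?_), (circleAverage_log_norm_sub hr.1 hr.2).ge⟩
  intro z hz hza
  rw [mem_singleton_iff] at hza
  subst hza
  rw [mem_sphere, dist_eq_norm, norm_sub_rev] at hz
  linarith [hr.2]

theorem exists_selection (z₀ : ℂ) (R : ℝ) (hR : 0 < R) (K : Set ℂ) (hK : IsClosed K)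
    (h : ∀ τ ∈ Icc (1/8:ℝ) (1/4), ∃ z ∈ K, ‖z - z₀‖ = R * τ) :
    ∃ s : ℝ → ℂ, Measurable s ∧ ∀ τ ∈ Icc (1/8:ℝ) (1/4), s τ ∈ K ∧ ‖s τ - z₀‖ = R * τ := by
  set A : Set (ℝ × ℝ) := (Icc (1/8:ℝ) (1/4) ×ˢ Icc (0:ℝ) (2 * Real.pi)) ∩
    (fun p : ℝ × ℝ => circleMap z₀ (R * p.1) p.2) ⁻¹' K with hA
  have hcont : Continuous (fun p : ℝ × ℝ => circleMap z₀ (R * p.1) p.2) := by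
    unfold circleMap; fun_prop
  have hAc : IsCompact A := (isCompact_Icc.prod isCompact_Icc).inter_right (hK.preimage hcont)
  set α : ℝ → ℝ := fun τ => sInf {a | (τ, a) ∈ A} with hα
  have hbdd : ∀ τ, BddBelow {a | (τ, a) ∈ A} := fun τ => ⟨0, fun a ha => ha.1.2.1⟩
  have hne : ∀ τ ∈ Icc (1/8:ℝ) (1/4), {a | (τ, a) ∈ A}.Nonempty := by
    intro τ hτ
    obtain ⟨z, hz, hn⟩ := h τ hτ
    have hRτ : 0 ≤ R * τ := mul_nonneg hR.le (by linarith [hτ.1])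
    have hzs : z ∈ sphere z₀ |R * τ| := by
      rw [mem_sphere, dist_eq_norm, hn, abs_of_nonneg hRτ]
    rw [← image_circleMap_Ioc] at hzs
    obtain ⟨a, ha, rfl⟩ := hzs
    exact ⟨a, ⟨hτ, Ioc_subset_Icc_self ha⟩, hz⟩
  have hcl : ∀ τ, IsClosed {a | (τ, a) ∈ A} := fun τ =>
    hAc.isClosed.preimage (f := fun a : ℝ => (τ, a)) (by fun_prop)
  have hmem : ∀ τ ∈ Icc (1/8:ℝ) (1/4), (τ, α τ) ∈ A := fun τ hτ =>
    (hcl τ).csInf_mem (hne τ hτ) (hbdd τ)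
  have hmeas : Measurable α := by
    apply measurable_of_Iic
    intro c
    have : α ⁻¹' Iic c = (Prod.fst '' (A ∩ {p | p.2 ≤ c})) ∪
        ((Icc (1/8:ℝ) (1/4))ᶜ ∩ {_τ | (0:ℝ) ≤ c}) := by
      ext τ
      constructor
      · intro hτ
        by_cases hi : τ ∈ Icc (1/8:ℝ) (1/4)
        · left
          exact ⟨(τ, α τ), ⟨hmem τ hi, hτ⟩, rfl⟩
        · right
          refine ⟨hi, ?_⟩
          have he : {a | (τ, a) ∈ A} = ∅ := by
            ext a; constructor
            · intro ha; exact hi ha.1.1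
            · intro ha; exact ha.elim
          have : α τ = 0 := by simp only [hα]; rw [he]; exact Real.sInf_empty
          have h2 : α τ ≤ c := hτ
          show (0:ℝ) ≤ c
          linarith
      · rintro (⟨⟨τ', a⟩, ⟨ha, hac⟩, rfl⟩ | ⟨hi, hc⟩)
        · exact (csInf_le (hbdd τ') ha).trans hac
        · have he : {a | (τ, a) ∈ A} = ∅ := by
            ext a; constructor
            · intro ha; exact hi ha.1.1
            · intro ha; exact ha.elim
          have h0 : α τ = 0 := by simp only [hα]; rw [he]; exact Real.sInf_empty
          show α τ ≤ c
          rw [h0]; exact hc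
    rw [this]
    refine MeasurableSet.union ?_ (measurableSet_Icc.compl.inter (MeasurableSet.const _))
    refine IsCompact.measurableSet (IsCompact.image ?_ continuous_fst)
    exact hAc.inter_right (isClosed_le continuous_snd continuous_const)
  refine ⟨fun τ => circleMap z₀ (R * τ) (α τ), ?_, fun τ hτ => ⟨(hmem τ hτ).2, ?_⟩⟩
  · exact hcont.measurable.comp (measurable_id.prodMk hmeas)
  · have hRτ : 0 ≤ R * τ := mul_nonneg hR.le (by linarith [hτ.1])
    simp [circleMap, abs_of_pos hR, abs_of_nonneg (show (0:ℝ) ≤ τ by linarith [hτ.1])]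

/-- logarithmic potential of the pushforward of Lebesgue measure under `s`. -/
noncomputable def logPot (s : ℝ → ℂ) (z : ℂ) : ℝ := ∫ τ in (1/8:ℝ)..(1/4), Real.log ‖z - s τ‖

theorem log_bound {x d M : ℝ} (hd : 0 < d) (h1 : d ≤ x) (h2 : x ≤ M) :
    ‖Real.log x‖ ≤ max |Real.log d| |Real.log M| := by
  rw [Real.norm_eq_abs]
  exact abs_le_max_abs_abs (Real.log_le_log hd h1) (Real.log_le_log (hd.trans_le h1) h2)

theorem logPot_dist {s : ℝ → ℂ} {K : Set ℂ} (hK : IsCompact K)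
    (hsK : ∀ τ ∈ Icc (1/8:ℝ) (1/4), s τ ∈ K) {c : ℂ} (hc : c ∉ K) :
    ∃ d > 0, ball c d ⊆ Kᶜ ∧ ∃ M, ∀ z ∈ ball c d, ∀ τ ∈ Icc (1/8:ℝ) (1/4), d < ‖z - s τ‖ ∧ ‖z - s τ‖ ≤ M := by
  obtain ⟨e, he, hball⟩ := Metric.isOpen_iff.1 hK.isClosed.isOpen_compl c hc
  obtain ⟨C, hC⟩ := hK.isBounded.exists_norm_le
  refine ⟨e/2, by positivity, (ball_subset_ball (by linarith)).trans hball, ‖c‖ + e/2 + C, fun z hz τ hτ => ⟨?_, ?_⟩⟩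
  · by_contra hlt
    push Not at hlt
    refine hball ?_ (hsK τ hτ)
    rw [mem_ball, dist_comm] 
    rw [mem_ball, dist_comm] at hz
    calc dist c (s τ) ≤ dist c z + dist z (s τ) := dist_triangle _ _ _
      _ < e := by rw [dist_eq_norm z]; linarith
  · have h1 := hC _ (hsK τ hτ)
    rw [mem_ball, dist_eq_norm] at hz
    calc ‖z - s τ‖ = ‖c + (z - c) - s τ‖ := by ring_nf
      _ ≤ ‖c + (z - c)‖ + ‖s τ‖ := norm_sub_le _ _
      _ ≤ ‖c‖ + ‖z - c‖ + ‖s τ‖ := by gcongr; exact norm_add_le _ _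
      _ ≤ _ := by linarith

theorem uIoc_sub {τ : ℝ} (h : τ ∈ Set.uIoc (1/8:ℝ) (1/4)) : τ ∈ Icc (1/8:ℝ) (1/4) := by
  rw [uIoc_of_le (by norm_num)] at h
  exact Ioc_subset_Icc_self h

theorem logPot_intervalIntegrable {s : ℝ → ℂ} {K : Set ℂ} (hs : Measurable s) (hK : IsCompact K)
    (hsK : ∀ τ ∈ Icc (1/8:ℝ) (1/4), s τ ∈ K) {c : ℂ} (hc : c ∉ K) :
    IntervalIntegrable (fun τ => Real.log ‖c - s τ‖) volume (1/8:ℝ) (1/4) := by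
  obtain ⟨d, hd, hdK, M, h⟩ := logPot_dist hK hsK hc
  refine (intervalIntegrable_const (c := max |Real.log d| |Real.log M|)).mono_fun ?_ ?_
  · exact (Measurable.log (measurable_const.sub hs).norm).aestronglyMeasurable
  · rw [EventuallyLE, ae_restrict_iff' measurableSet_uIoc]
    refine Eventually.of_forall fun τ hτ => ?_
    have := h c (mem_ball_self hd) τ (uIoc_sub hτ)
    refine (log_bound hd this.1.le this.2).trans (le_abs_self _)

theorem logPot_continuousOn {s : ℝ → ℂ} {K : Set ℂ} (hs : Measurable s) (hK : IsCompact K)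
    (hsK : ∀ τ ∈ Icc (1/8:ℝ) (1/4), s τ ∈ K) : ContinuousOn (logPot s) Kᶜ := by
  intro c hc
  apply ContinuousAt.continuousWithinAt
  obtain ⟨d, hd, hdK, M, h⟩ := logPot_dist hK hsK hc
  apply intervalIntegral.continuousAt_of_dominated_interval
    (bound := fun _ => max |Real.log d| |Real.log M|)
  · exact Eventually.of_forall fun z =>
      (Measurable.log (measurable_const.sub hs).norm).aestronglyMeasurable
  · filter_upwards [ball_mem_nhds c hd] with z hz
    refine Eventually.of_forall fun τ hτ => ?_
    have := h z hz τ (uIoc_sub hτ)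
    exact log_bound hd this.1.le this.2
  · exact intervalIntegrable_const
  · refine Eventually.of_forall fun τ hτ => ?_
    have := h c (mem_ball_self hd) τ (uIoc_sub hτ)
    refine ContinuousAt.log (by fun_prop) (hd.trans this.1).ne'

theorem logPot_lsub {s : ℝ → ℂ} {K : Set ℂ} (hs : Measurable s) (hK : IsCompact K)
    (hsK : ∀ τ ∈ Icc (1/8:ℝ) (1/4), s τ ∈ K) : LSub (fun z => - logPot s z) Kᶜ := by
  have hcont := logPot_continuousOn hs hK hsK
  refine ⟨hcont.neg.upperSemicontinuousOn, fun c hc => ?_⟩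
  obtain ⟨d, hd, hdK, M, h⟩ := logPot_dist hK hsK hc
  filter_upwards [(Ioo_mem_nhdsGT hd : Ioo 0 d ∈ 𝓝[>] (0:ℝ))] with r hr
  have hsph : sphere c r ⊆ ball c d := fun z hz => by
    rw [mem_sphere] at hz; rw [mem_ball]; linarith [hr.2]
  have hin : ∀ θ, circleMap c r θ ∈ ball c d := fun θ => hsph (circleMap_mem_sphere c hr.1.le θ)
  -- Fubini
  have hswap : (∫ θ in (0:ℝ)..(2 * Real.pi), logPot s (circleMap c r θ)) =
      ∫ τ in (1/8:ℝ)..(1/4), ∫ θ in (0:ℝ)..(2 * Real.pi), Real.log ‖circleMap c r θ - s τ‖ := by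
    unfold logPot
    rw [intervalIntegral.integral_of_le (show (1/8:ℝ) ≤ 1/4 by norm_num)]
    simp_rw [intervalIntegral.integral_of_le (show (1/8:ℝ) ≤ 1/4 by norm_num)]
    rw [intervalIntegral_integral_swap]
    have : IsFiniteMeasure (volume.restrict (Set.uIoc 0 (2 * Real.pi))) := by
      unfold Set.uIoc; infer_instance
    refine Integrable.mono' (g := fun _ => max |Real.log d| |Real.log M|)
      (integrable_const _) ?_ ?_
    · apply Measurable.aestronglyMeasurable
      apply Measurable.log
      apply Measurable.norm
      exact ((continuous_circleMap c r).measurable.comp measurable_fst).sub (hs.comp measurable_snd)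
    · rw [Measure.prod_restrict, ae_restrict_iff' (measurableSet_uIoc.prod measurableSet_Ioc)]
      refine Eventually.of_forall fun p hp => ?_
      have := h _ (hin p.1) p.2 (Ioc_subset_Icc_self hp.2)
      exact log_bound hd this.1.le this.2
  have hci : CircleIntegrable (fun z => - logPot s z) c r :=
    ContinuousOn.circleIntegrable hr.1.le (hcont.neg.mono (hsph.trans hdK))
  refine ⟨hci, le_of_eq ?_⟩
  have hinner : (∫ τ in (1/8:ℝ)..(1/4), ∫ θ in (0:ℝ)..(2 * Real.pi),
      Real.log ‖circleMap c r θ - s τ‖) =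
      ∫ τ in (1/8:ℝ)..(1/4), (2 * Real.pi) * Real.log ‖c - s τ‖ := by
    apply intervalIntegral.integral_congr
    intro τ hτ
    rw [uIcc_of_le (by norm_num)] at hτ
    have h1 := circleAverage_log_norm_sub hr.1 (hr.2.trans (h c (mem_ball_self hd) τ hτ).1)
    rw [Real.circleAverage_def, smul_eq_mul, ← div_eq_inv_mul, div_eq_iff Real.two_pi_pos.ne'] at h1
    simp only
    rw [h1, mul_comm]
  rw [Real.circleAverage_def, intervalIntegral.integral_neg, hswap, hinner,
    intervalIntegral.integral_const_mul, smul_eq_mul]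
  unfold logPot
  field_simp


theorem xlogx_bound {x : ℝ} (h : |x| ≤ 1) : |x * Real.log x| ≤ 1 := by
  rcases eq_or_ne x 0 with rfl | h0
  · simp
  · have := Real.abs_log_mul_self_lt |x| (abs_pos.2 h0) h
    rw [Real.log_abs, abs_mul, abs_abs] at this
    rw [abs_mul, mul_comm]
    exact this.le

theorem logPot_lower {s : ℝ → ℂ} {K : Set ℂ} (hs : Measurable s) (hK : IsCompact K)
    {z₀ : ℂ} {R : ℝ} (hR : 0 < R)
    (hsK : ∀ τ ∈ Icc (1/8:ℝ) (1/4), s τ ∈ K ∧ ‖s τ - z₀‖ = R * τ) {z : ℂ} (hz : z ∉ K)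
    (hzR : ‖z - z₀‖ ≤ R) : Real.log R / 8 - 4 ≤ logPot s z := by
  set x := ‖z - z₀‖ / R with hx
  have hx0 : 0 ≤ x := by positivity
  have hx1 : x ≤ 1 := by rw [hx, div_le_one hR]; exact hzR
  have hxR : ‖z - z₀‖ = R * x := by rw [hx]; field_simp
  have hII : IntervalIntegrable (fun τ : ℝ => Real.log (x - τ)) volume (1/8) (1/4) := by
    have := (intervalIntegral.intervalIntegrable_log' (a := x - 1/8) (b := x - 1/4)).comp_sub_left x
    simpa using this
  have hI : (∫ τ in (1/8:ℝ)..(1/4), (Real.log R + Real.log (x - τ))) ≤ logPot s z := by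
    unfold logPot
    apply intervalIntegral.integral_mono_ae_restrict (by norm_num)
      (intervalIntegrable_const.add hII)
      (logPot_intervalIntegrable hs hK (fun τ hτ => (hsK τ hτ).1) hz)
    have hne : ∀ᵐ τ : ℝ ∂(volume.restrict (Icc (1/8:ℝ) (1/4))), τ ≠ x :=
      ae_restrict_of_ae (Measure.ae_ne volume x)
    filter_upwards [hne, ae_restrict_mem measurableSet_Icc] with τ hτ hm
    rw [← Real.log_abs (x - τ), ← Real.log_mul hR.ne' (abs_pos.2 (sub_ne_zero.2 hτ.symm)).ne']
    have habs : 0 < |x - τ| := abs_pos.2 (sub_ne_zero.2 hτ.symm)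
    apply Real.log_le_log (by positivity)
    have h1 := abs_norm_sub_norm_le (z - z₀) (s τ - z₀)
    rw [hxR, (hsK τ hm).2, ← mul_sub, abs_mul, abs_of_pos hR] at h1
    simpa using h1
  rw [intervalIntegral.integral_add intervalIntegrable_const hII,
    intervalIntegral.integral_const, intervalIntegral.integral_comp_sub_left
      (fun y => Real.log y), integral_log] at hI
  have h1 := xlogx_bound (x := x - 1/8) (abs_le.2 ⟨by linarith, by linarith⟩)
  have h2 := xlogx_bound (x := x - 1/4) (abs_le.2 ⟨by linarith, by linarith⟩)
  rw [abs_le] at h1 h2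
  simp only [smul_eq_mul] at hI
  linarith [h1.1, h1.2, h2.1, h2.2]

theorem logPot_ge_const {s : ℝ → ℂ} {K : Set ℂ} (hs : Measurable s) (hK : IsCompact K)
    (hsK : ∀ τ ∈ Icc (1/8:ℝ) (1/4), s τ ∈ K) {z : ℂ} (hz : z ∉ K) {a : ℝ} (ha : 0 < a)
    (h : ∀ τ ∈ Icc (1/8:ℝ) (1/4), a ≤ ‖z - s τ‖) : Real.log a / 8 ≤ logPot s z := by
  have : (∫ _τ in (1/8:ℝ)..(1/4), Real.log a) ≤ logPot s z := by
    apply intervalIntegral.integral_mono_on (by norm_num) intervalIntegrable_const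
      (logPot_intervalIntegrable hs hK hsK hz)
    intro τ hτ
    exact Real.log_le_log ha (h τ hτ)
  rw [intervalIntegral.integral_const, smul_eq_mul] at this
  linarith

theorem logPot_le_const {s : ℝ → ℂ} {K : Set ℂ} (hs : Measurable s) (hK : IsCompact K)
    (hsK : ∀ τ ∈ Icc (1/8:ℝ) (1/4), s τ ∈ K) {z : ℂ} (hz : z ∉ K) {a : ℝ}
    (h : ∀ τ ∈ Icc (1/8:ℝ) (1/4), ‖z - s τ‖ ≤ a) : logPot s z ≤ Real.log a / 8 := by
  have : logPot s z ≤ (∫ _τ in (1/8:ℝ)..(1/4), Real.log a) := by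
    apply intervalIntegral.integral_mono_on (by norm_num) 
      (logPot_intervalIntegrable hs hK hsK hz) intervalIntegrable_const
    intro τ hτ
    refine Real.log_le_log (norm_pos_iff.2 (sub_ne_zero.2 ?_)) (h τ hτ)
    rintro rfl
    exact hz (hsK τ hτ)
  rw [intervalIntegral.integral_const, smul_eq_mul] at this
  linarith

theorem exists_circle {V : ℂ → ℝ} {B : Set ℂ} {z₀ : ℂ} {ρ δ : ℝ} (hρ : 0 < ρ) (hδ : 0 < δ)
    (hV : LSub V (ball z₀ ρ)) (hBV : ∀ z ∈ B, z ∈ ball z₀ ρ → z ≠ z₀ → V z ≤ V z₀ - δ)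
    (hBc : ∀ z ∈ ball z₀ ρ, z ∈ closure B → z ∈ B) :
    ∃ r ∈ Ioo 0 ρ, sphere z₀ r ∩ B = ∅ := by
  by_contra hcon
  push Not at hcon
  have hl2 : 0 < Real.log 2 := Real.log_pos (by norm_num)
  set η := δ * Real.log 2 / 100 with hη
  have hη0 : 0 < η := by positivity
  have h1 := hV.1 z₀ (mem_ball_self hρ) (V z₀ + η) (show V z₀ < V z₀ + η by linarith)
  rw [isOpen_ball.nhdsWithin_eq (mem_ball_self hρ), Metric.eventually_nhds_iff_ball] at h1
  obtain ⟨ε, hε, hVε⟩ := h1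
  set R := min ρ ε / 2 with hRdef
  have hm : 0 < min ρ ε := lt_min hρ hε
  have hR : 0 < R := by positivity
  have hRρ : R < ρ := by have := min_le_left ρ ε; linarith
  have hRε : R < ε := by have := min_le_right ρ ε; linarith
  set K : Set ℂ := closure B ∩ {z | R / 8 ≤ ‖z - z₀‖ ∧ ‖z - z₀‖ ≤ R / 4} with hKdef
  have hKc : IsClosed K := by
    refine isClosed_closure.inter ?_
    rw [setOf_and]
    exact (isClosed_le (by fun_prop) (by fun_prop)).inter (isClosed_le (by fun_prop) (by fun_prop))
  have hKball : K ⊆ closedBall z₀ (R / 4) := fun z hz => by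
    rw [mem_closedBall, dist_eq_norm]; exact hz.2.2
  have hK : IsCompact K := (isCompact_closedBall z₀ (R/4)).of_isClosed_subset hKc hKball
  have hKρ : K ⊆ ball z₀ ρ := hKball.trans (closedBall_subset_ball (by linarith))
  have hz₀K : z₀ ∉ K := fun h => by
    have := h.2.1
    simp at this; linarith
  have hVK : ∀ z ∈ K, V z ≤ V z₀ - δ := fun z hz =>
    hBV z (hBc z (hKρ hz) hz.1) (hKρ hz) (fun h => hz₀K (h ▸ hz))
  obtain ⟨s, hs, hsel⟩ := exists_selection z₀ R hR K hKc (by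
    intro τ hτ
    have hτ0 : 0 < τ := by linarith [hτ.1]
    have hlt : R * τ < ρ := by nlinarith [hτ.2]
    obtain ⟨z, hz1, hz2⟩ := hcon (R * τ) ⟨by positivity, hlt⟩
    rw [mem_sphere, dist_eq_norm] at hz1
    refine ⟨z, ⟨subset_closure hz2, ?_, ?_⟩, hz1⟩
    · rw [hz1]; nlinarith [hτ.1]
    · rw [hz1]; nlinarith [hτ.2])
  have hsK : ∀ τ ∈ Icc (1/8:ℝ) (1/4), s τ ∈ K := fun τ hτ => (hsel τ hτ).1
  have hΩo : IsOpen (ball z₀ R \ K) := isOpen_ball.sdiff hKc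
  have hsub : LSub (fun z => - logPot s z + 10 / δ * (V z + (- V z₀))) (ball z₀ R \ K) := by
    apply LSub.add
    · exact (logPot_lsub hs hK hsK).mono fun z hz => hz.2
    · apply LSub.cmul _ (by positivity)
      exact (hV.mono (sdiff_subset.trans (ball_subset_ball hRρ.le))).add (LSub.const _ _)
  have hlower : ∀ z ∈ ball z₀ R \ K, Real.log R / 8 - 4 ≤ logPot s z := fun z hz =>
    logPot_lower hs hK hR hsel hz.2 (by have := hz.1; rw [mem_ball, dist_eq_norm] at this; exact this.le)
  have hmp := hsub.maxPrinciple hΩo (isBounded_ball.subset sdiff_subset)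
    (- Real.log (R / 2) / 8 + 10 / δ * η) (by
    intro ζ hζ1 hζ2
    have hζR : ζ ∈ closedBall z₀ R :=
      closure_ball_subset_closedBall (closure_mono sdiff_subset hζ1)
    have hlogR2 : Real.log (R / 2) = Real.log R - Real.log 2 := Real.log_div hR.ne' (by norm_num)
    by_cases hζK : ζ ∈ K
    · have h2 := hV.1 ζ (hKρ hζK) (V z₀ - δ / 2) (show V ζ < _ by linarith [hVK ζ hζK])
      have h3 := h2.filter_mono (nhdsWithin_mono ζ (sdiff_subset.trans (ball_subset_ball hRρ.le) : ball z₀ R \ K ⊆ ball z₀ ρ))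
      filter_upwards [h3, self_mem_nhdsWithin] with z hz hzΩ
      have h4 := hlower z hzΩ
      have h5 : V z + (- V z₀) ≤ - δ / 2 := by
        have : V z < V z₀ - δ / 2 := hz
        linarith
      have h6 : 10 / δ * (V z + (- V z₀)) ≤ -5 := by
        calc _ ≤ 10 / δ * (- δ / 2) := by gcongr
          _ = -5 := by field_simp; norm_num
      have h7 : 0 ≤ 10 / δ * η := by positivity
      linarith
    · have hζs : ‖ζ - z₀‖ = R := by
        rw [mem_closedBall, dist_eq_norm] at hζR
        refine le_antisymm hζR ?_
        by_contra hlt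
        exact hζ2 ⟨by rw [mem_ball, dist_eq_norm]; linarith, hζK⟩
      have h2 : ∀ᶠ z in 𝓝 ζ, 3 / 4 * R < ‖z - z₀‖ := by
        have hcn : ContinuousAt (fun z : ℂ => ‖z - z₀‖) ζ := by fun_prop
        exact hcn.eventually (lt_mem_nhds (show 3 / 4 * R < ‖ζ - z₀‖ by rw [hζs]; linarith))
      filter_upwards [nhdsWithin_le_nhds h2, self_mem_nhdsWithin] with z hz hzΩ
      have h4 : Real.log (R / 2) / 8 ≤ logPot s z := by
        apply logPot_ge_const hs hK hsK hzΩ.2 (by positivity)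
        intro τ hτ
        have h5 := (hsel τ hτ).2
        have h6 := norm_sub_norm_le (z - z₀) (s τ - z₀)
        rw [sub_sub_sub_cancel_right, h5] at h6
        nlinarith [hτ.2]
      have h5 : V z < V z₀ + η := hVε z (ball_subset_ball hRε.le hzΩ.1)
      have h6 : 10 / δ * (V z + (- V z₀)) ≤ 10 / δ * η := by
        gcongr; linarith
      linarith)
  have hfin := hmp z₀ ⟨mem_ball_self hR, hz₀K⟩
  have h8 : logPot s z₀ ≤ Real.log (R / 4) / 8 := by
    apply logPot_le_const hs hK hsK hz₀K
    intro τ hτ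
    rw [norm_sub_rev, (hsel τ hτ).2]
    nlinarith [hτ.2]
  have h9 : Real.log (R / 4) = Real.log R - 2 * Real.log 2 := by
    rw [Real.log_div hR.ne' (by norm_num), show (4:ℝ) = 2 ^ 2 by norm_num, Real.log_pow]; norm_num
  have h10 : Real.log (R / 2) = Real.log R - Real.log 2 := Real.log_div hR.ne' (by norm_num)
  have h11 : 10 / δ * η = Real.log 2 / 10 := by rw [hη]; field_simp; norm_num
  simp only [add_neg_cancel, mul_zero, add_zero] at hfin
  rw [h11] at hfin
  linarith


theorem extremal_est {V U : ℂ → ℝ} {B : Set ℂ} {z₀ : ℂ} {ρ δ r : ℝ} (hδ : 0 < δ) (hr : 0 < r)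
    (hrρ : r < ρ) (hV : LSub V (ball z₀ ρ))
    (hVb : ∀ z ∈ ball z₀ ρ, V z ≤ V z₀ + δ / 4)
    (hBV : ∀ z ∈ B, z ∈ ball z₀ ρ → z ≠ z₀ → V z ≤ V z₀ - δ)
    (hBc : ∀ z ∈ ball z₀ ρ, z ∈ closure B → z ∈ B)
    (hU : LSub U (ball z₀ r \ B)) (hU0 : ∀ z ∈ ball z₀ r \ B, U z ≤ 0)
    (hU1 : ∀ ζ ∈ sphere z₀ r, ∀ ε > 0, ∀ᶠ z in 𝓝[ball z₀ r \ B] ζ, U z ≤ -1 + ε)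
    {z : ℂ} (hz : z ∈ ball z₀ r \ B) (hzz : z ≠ z₀) (hVz : V z₀ - δ / 4 ≤ V z) :
    U z ≤ -(1/2) := by
  have hVeq : ∀ z, V z + (-(V z₀ + δ / 4)) = V z - (V z₀ + δ / 4) := fun z => by ring
  set Ω : Set ℂ := (ball z₀ r \ closure B) \ {z₀} with hΩ
  have hΩo : IsOpen Ω := (isOpen_ball.sdiff isClosed_closure).sdiff isClosed_singleton
  have hΩr : Ω ⊆ ball z₀ r := fun z hz => hz.1.1
  have hΩρ : Ω ⊆ ball z₀ ρ := hΩr.trans (ball_subset_ball hrρ.le)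
  have hΩB : Ω ⊆ ball z₀ r \ B := fun z hz => ⟨hz.1.1, fun h => hz.1.2 (subset_closure h)⟩
  have hzΩ : z ∈ Ω :=
    ⟨⟨hz.1, fun h => hz.2 (hBc z (ball_subset_ball hrρ.le hz.1) h)⟩, hzz⟩
  have main : ∀ ε > 0, U z + 1 / δ * (V z + (-(V z₀ + δ / 4)))
      + ε * (Real.log ‖z - z₀‖ + (- Real.log r)) ≤ -1 + ε := by
    intro ε hε
    have hsub : LSub (fun z => U z + 1 / δ * (V z + (-(V z₀ + δ / 4)))
      + ε * (Real.log ‖z - z₀‖ + (- Real.log r))) Ω := by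
      refine LSub.add (LSub.add (hU.mono hΩB) (LSub.cmul ?_ (by positivity))) (LSub.cmul ?_ hε)
      · exact (hV.mono hΩρ).add (LSub.const _ _)
      · exact ((lsub_log z₀).mono fun z hz => hz.2).add (LSub.const _ _)
    have hVn : ∀ z ∈ Ω, 1 / δ * (V z + (-(V z₀ + δ / 4))) ≤ 0 := fun z hz =>
      mul_nonpos_of_nonneg_of_nonpos (by positivity) (by linarith [hVb z (hΩρ hz)])
    have hLn : ∀ z ∈ Ω, ε * (Real.log ‖z - z₀‖ + (- Real.log r)) ≤ 0 := fun z hz => by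
      apply mul_nonpos_of_nonneg_of_nonpos hε.le
      have h1 : ‖z - z₀‖ < r := by simpa [dist_eq_norm] using hΩr hz
      have h2 := Real.log_le_log (norm_pos_iff.2 (sub_ne_zero.2 hz.2)) h1.le
      linarith
    refine hsub.maxPrinciple hΩo (isBounded_ball.subset hΩr) (-1 + ε) ?_ z hzΩ
    intro ζ hζ1 hζ2
    have hζR : ζ ∈ closedBall z₀ r := closure_ball_subset_closedBall (closure_mono hΩr hζ1)
    have hζρ : ζ ∈ ball z₀ ρ := closedBall_subset_ball hrρ hζR
    by_cases hζ0 : ζ = z₀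
    · subst hζ0
      have ht : Tendsto (fun z : ℂ => Real.log ‖z - ζ‖) (𝓝[≠] ζ) atBot := by
        refine Real.tendsto_log_nhdsNE_zero.comp ?_
        refine tendsto_nhdsWithin_iff.2 ⟨?_, ?_⟩
        · have hcn : ContinuousAt (fun z : ℂ => ‖z - ζ‖) ζ := by fun_prop
          have := hcn.tendsto
          simp only [sub_self, norm_zero] at this
          exact this.mono_left nhdsWithin_le_nhds
        · filter_upwards [self_mem_nhdsWithin] with w hw
          exact norm_ne_zero_iff.2 (sub_ne_zero.2 hw)
      have h2 := ht.eventually (eventually_le_atBot (Real.log r - 1 / ε))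
      have h3 := h2.filter_mono (nhdsWithin_mono ζ (fun w hw => hw.2 : Ω ⊆ {ζ}ᶜ))
      filter_upwards [h3, self_mem_nhdsWithin] with w hw hwΩ
      have h4 : ε * (Real.log ‖w - ζ‖ + (- Real.log r)) ≤ -1 := by
        calc _ ≤ ε * (- (1 / ε)) := by gcongr; linarith
          _ = -1 := by field_simp
      linarith [hU0 w (hΩB hwΩ), hVn w hwΩ]
    · by_cases hζB : ζ ∈ closure B
      · have hζB' := hBc ζ hζρ hζB
        have h2 := hV.1 ζ hζρ (V z₀ - 3 / 4 * δ)
          (show V ζ < _ by linarith [hBV ζ hζB' hζρ hζ0])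
        have h3 := h2.filter_mono (nhdsWithin_mono ζ hΩρ)
        filter_upwards [h3, self_mem_nhdsWithin] with w hw hwΩ
        have hw' : V w < V z₀ - 3 / 4 * δ := hw
        have h4 : 1 / δ * (V w + (-(V z₀ + δ / 4))) ≤ -1 := by
          calc _ ≤ 1 / δ * (- δ) := by gcongr; linarith
            _ = -1 := by field_simp
        linarith [hU0 w (hΩB hwΩ), hLn w hwΩ]
      · have hζs : ζ ∈ sphere z₀ r := by
          rw [mem_closedBall] at hζR
          rw [mem_sphere]
          refine le_antisymm hζR ?_
          by_contra hlt
          exact hζ2 ⟨⟨by rw [mem_ball]; linarith, hζB⟩, hζ0⟩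
        have h3 := (hU1 ζ hζs ε hε).filter_mono (nhdsWithin_mono ζ hΩB)
        filter_upwards [h3, self_mem_nhdsWithin] with w hw hwΩ
        linarith [hVn w hwΩ, hLn w hwΩ]
  have hA : -(1/2) ≤ 1 / δ * (V z + (-(V z₀ + δ / 4))) := by
    calc -(1/2) = 1 / δ * (- (δ / 2)) := by field_simp
      _ ≤ _ := by gcongr; linarith
  set L := Real.log ‖z - z₀‖ + (- Real.log r) with hL
  have hlim : Tendsto (fun ε : ℝ => -1 + ε - ε * L + 1 / 2) (𝓝[>] 0) (𝓝 (-(1/2))) := by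
    have hcn : Continuous (fun ε : ℝ => -1 + ε - ε * L + 1 / 2) := by fun_prop
    have := hcn.tendsto 0
    norm_num at this
    have h2 := this.mono_left (nhdsWithin_le_nhds (s := Ioi 0))
    norm_num
    exact h2
  refine ge_of_tendsto hlim ?_
  filter_upwards [self_mem_nhdsWithin] with ε hε
  linarith [main ε hε]

theorem thin_barrier {D B : Set ℂ} {z₀ : ℂ} (hD : IsOpen D) (hz₀ : z₀ ∈ D) (hthin : ThinAt B z₀) :
    ∃ V : ℂ → ℝ, ∃ ρ > 0, ∃ δ > 0, ball z₀ ρ ⊆ D ∧ LSub V (ball z₀ ρ) ∧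
      (∀ z ∈ ball z₀ ρ, V z ≤ V z₀ + δ / 4) ∧
      ∀ z ∈ B, z ∈ ball z₀ ρ → z ≠ z₀ → V z ≤ V z₀ - δ := by
  obtain ⟨ρ₀, hρ₀, hρD⟩ := Metric.isOpen_iff.1 hD z₀ hz₀
  rcases hthin with h | ⟨U, hU, hzU, u, hu, hlim⟩
  · obtain ⟨ε, hε, hεB⟩ := Metric.isOpen_iff.1 isClosed_closure.isOpen_compl z₀ h
    refine ⟨fun _ => 0, min ρ₀ ε, lt_min hρ₀ hε, 1, one_pos,
      (ball_subset_ball (min_le_left _ _)).trans hρD, LSub.const _ _, fun z _ => by norm_num, ?_⟩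
    intro z hzB hz hne
    have hmem : z ∈ B \ {z₀} := ⟨hzB, hne⟩
    exact absurd (subset_closure hmem) (hεB (ball_subset_ball (min_le_right _ _) hz))
  · obtain ⟨c, hc1, hc2⟩ := EReal.exists_between_coe_real hlim
    have hev := eventually_lt_of_limsup_lt hc1
    rw [eventually_nhdsWithin_iff, Metric.eventually_nhds_iff_ball] at hev
    obtain ⟨ε₁, hε₁, hB⟩ := hev
    obtain ⟨ε₂, hε₂, hBU⟩ := Metric.isOpen_iff.1 hU z₀ hzU
    have hls := hu.lsub hU c
    set V : ℂ → ℝ := fun z => (max (u z) (c : EReal)).toReal with hVdef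
    have hV0 : c < V z₀ := by
      have : V z₀ = (u z₀).toReal := by simp only [hVdef]; rw [max_eq_left hc2.le]
      rw [this, ← EReal.coe_lt_coe_iff, EReal.coe_toReal (hu.1 _ hzU)
        ((EReal.bot_lt_coe c).trans hc2).ne']
      exact hc2
    set δ := V z₀ - c with hδ
    have hδ0 : 0 < δ := sub_pos.2 hV0
    have h1 := hls.1 z₀ hzU (V z₀ + δ / 4) (show V z₀ < _ by linarith)
    rw [hU.nhdsWithin_eq hzU, Metric.eventually_nhds_iff_ball] at h1
    obtain ⟨ε₃, hε₃, hVε⟩ := h1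
    refine ⟨V, min (min ρ₀ ε₁) (min ε₂ ε₃), by positivity, δ, hδ0, ?_, ?_, ?_, ?_⟩
    · exact (ball_subset_ball ((min_le_left _ _).trans (min_le_left _ _))).trans hρD
    · exact hls.mono ((ball_subset_ball ((min_le_right _ _).trans (min_le_left _ _))).trans hBU)
    · intro z hz
      exact le_of_lt (hVε z (ball_subset_ball ((min_le_right _ _).trans (min_le_right _ _)) hz))
    · intro z hzB hz hne
      have h2 := hB z (ball_subset_ball ((min_le_left _ _).trans (min_le_right _ _)) hz) ⟨hzB, hne⟩
      have : V z = c := by simp only [hVdef]; rw [max_eq_right h2.le]; rfl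
      rw [this, hδ]; linarith

theorem exists_good_point {V : ℂ → ℝ} {z₀ : ℂ} {ρ δ : ℝ} (hρ : 0 < ρ) (hδ : 0 < δ)
    (hV : LSub V (ball z₀ ρ)) {e : ℝ} (he : 0 < e) :
    ∃ z, z ≠ z₀ ∧ dist z z₀ < e ∧ V z₀ - δ / 4 ≤ V z := by
  obtain ⟨r, ⟨hI, havg⟩, hr⟩ := ((hV.2 z₀ (mem_ball_self hρ)).and
    (Ioo_mem_nhdsGT he : ∀ᶠ r in 𝓝[>] (0:ℝ), r ∈ Ioo 0 e)).exists
  by_contra hcon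
  push Not at hcon
  have := Real.circleAverage_mono_on_of_le_circle (a := V z₀ - δ / 4) hI (by
    intro x hx
    rw [abs_of_pos hr.1, mem_sphere] at hx
    refine (hcon x ?_ (by rw [hx]; exact hr.2)).le
    rintro rfl
    rw [dist_self] at hx
    linarith [hr.1])
  linarith

/-- If `B` is closed in a domain `D ⊆ ℂ` and thin at `z₀ ∈ D`, then there
are radii `r_n → 0` and points `z_k → z₀` in `D \ B` such that the closed discs
`{|z - z₀| ≤ r_n}` lie in `D`, the circles `{|z - z₀| = r_n}` avoid `B`, and
`ω(z_k, ∂𝔻_{r_n}(z₀), 𝔻_{r_n}(z₀) \ B) ≥ 1/2` whenever `z_k ∈ 𝔻_{r_n}(z₀)`. -/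
theorem statement14 (D B : Set ℂ) (z₀ : ℂ)
    (hD : IsOpen D) (hDconn : IsConnected D)
    (hBD : B ⊆ D) (hBclosed : ∀ z ∈ D, z ∈ closure B → z ∈ B)
    (hz₀ : z₀ ∈ D) (hthin : ThinAt B z₀) :
    ∃ r : ℕ → ℝ, (∀ n, r n ∈ Set.Ioo (0:ℝ) 1) ∧ Filter.Tendsto r Filter.atTop (nhds 0) ∧
      ∃ zs : ℕ → ℂ, (∀ k, zs k ∈ D \ B) ∧ Filter.Tendsto zs Filter.atTop (nhds z₀) ∧
      ∀ n, Metric.closedBall z₀ (r n) ⊆ D ∧ Metric.sphere z₀ (r n) ∩ B = ∅ ∧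
        ∀ k, zs k ∈ Metric.ball z₀ (r n) →
          ((1/2 : ℝ) : EReal) ≤
            relExtremal (zs k) (Metric.sphere z₀ (r n)) (Metric.ball z₀ (r n) \ B) := by
  obtain ⟨V, ρ, hρ, δ, hδ, hρD, hV, hVb, hBV⟩ := thin_barrier hD hz₀ hthin
  have hBc : ∀ z ∈ ball z₀ ρ, z ∈ closure B → z ∈ B := fun z hz h => hBclosed z (hρD hz) h
  have hpos : ∀ n : ℕ, 0 < min (min ρ 1) (1 / ((n:ℝ) + 1)) := fun n =>
    lt_min (lt_min hρ one_pos) (by positivity)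
  have hrad : ∀ n : ℕ, ∃ r ∈ Ioo 0 (min (min ρ 1) (1 / ((n:ℝ) + 1))), sphere z₀ r ∩ B = ∅ := by
    intro n
    have hsub : ball z₀ (min (min ρ 1) (1 / ((n:ℝ) + 1))) ⊆ ball z₀ ρ :=
      ball_subset_ball ((min_le_left _ _).trans (min_le_left _ _))
    exact exists_circle (hpos n) hδ (hV.mono hsub)
      (fun z hz hz2 => hBV z hz (hsub hz2)) (fun z hz => hBc z (hsub hz))
  choose r hr hrB using hrad
  have hpt : ∀ k : ℕ, ∃ z, z ≠ z₀ ∧ dist z z₀ < min ρ (1 / ((k:ℝ) + 1)) ∧ V z₀ - δ / 4 ≤ V z :=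
    fun k => exists_good_point hρ hδ hV (lt_min hρ (by positivity))
  choose zs hzne hzd hzV using hpt
  have hzB : ∀ k, zs k ∉ B := fun k hk => by
    have h1 : zs k ∈ ball z₀ ρ := (hzd k).trans_le (min_le_left _ _)
    linarith [hBV _ hk h1 (hzne k), hzV k]
  have hrρ : ∀ n, r n < ρ := fun n => (hr n).2.trans_le ((min_le_left _ _).trans (min_le_left _ _))
  refine ⟨r, fun n => ⟨(hr n).1, (hr n).2.trans_le ((min_le_left _ _).trans (min_le_right _ _))⟩,
    ?_, zs, fun k => ⟨hρD ((hzd k).trans_le (min_le_left _ _)), hzB k⟩, ?_, fun n =>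
    ⟨(closedBall_subset_ball (hrρ n)).trans hρD, hrB n, fun k hk => ?_⟩⟩
  · exact squeeze_zero (fun n => (hr n).1.le) (fun n => (hr n).2.le.trans (min_le_right _ _))
      tendsto_one_div_add_atTop_nhds_zero_nat
  · rw [tendsto_iff_dist_tendsto_zero]
    exact squeeze_zero (fun n => dist_nonneg) (fun n => (hzd n).le.trans (min_le_right _ _))
      tendsto_one_div_add_atTop_nhds_zero_nat
  · unfold relExtremal
    rw [EReal.le_neg]
    apply sSup_le
    rintro y ⟨u, hu, hu0, hu1, rfl⟩
    have hopen : IsOpen (ball z₀ (r n) \ B) := by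
      have : ball z₀ (r n) \ B = ball z₀ (r n) \ closure B := by
        ext z
        exact ⟨fun h => ⟨h.1, fun h2 => h.2 (hBc z (ball_subset_ball (hrρ n).le h.1) h2)⟩,
          fun h => ⟨h.1, fun h2 => h.2 (subset_closure h2)⟩⟩
      rw [this]
      exact isOpen_ball.sdiff isClosed_closure
    have hcoe : ∀ z ∈ ball z₀ (r n) \ B,
        (((max (u z) ((-1 : ℝ) : EReal)).toReal : ℝ) : EReal) = max (u z) ((-1 : ℝ) : EReal) := by
      intro z hz
      apply EReal.coe_toReal
      · exact (max_lt (lt_top_iff_ne_top.2 (hu.1 z hz)) (EReal.coe_lt_top _)).ne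
      · exact (lt_of_lt_of_le (EReal.bot_lt_coe _) (le_max_right _ _)).ne'
    have hest := extremal_est hδ (hr n).1 (hrρ n) hV hVb hBV hBc (hu.lsub hopen (-1)) (by
      intro z hz
      rw [← EReal.coe_le_coe_iff, hcoe z hz]
      refine max_le (by simpa using hu0 z hz) ?_
      exact_mod_cast (by norm_num : (-1:ℝ) ≤ 0)) (by
      intro ζ hζ ε hε
      have h1 : limsup u (𝓝[insert ζ (ball z₀ (r n) \ B)] ζ) < ((-1 + ε : ℝ) : EReal) := by
        refine (hu1 ζ hζ).trans_lt ?_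
        have : ((-1 : ℝ) : EReal) < ((-1 + ε : ℝ) : EReal) := by
          rw [EReal.coe_lt_coe_iff]; linarith
        simpa using this
      have h2 := (eventually_lt_of_limsup_lt h1).filter_mono
        (nhdsWithin_mono ζ (subset_insert ζ (ball z₀ (r n) \ B)))
      filter_upwards [h2, self_mem_nhdsWithin] with w hw hwΩ
      rw [← EReal.coe_le_coe_iff, hcoe w hwΩ]
      refine max_le hw.le ?_
      rw [EReal.coe_le_coe_iff]; linarith) (z := zs k) ⟨hk, hzB k⟩ (hzne k) (hzV k)
    rw [← EReal.coe_le_coe_iff, hcoe _ ⟨hk, hzB k⟩] at hest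
    refine ((le_max_left _ _).trans hest).trans ?_
    rw [EReal.coe_neg]
end
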